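/- arXiv:1208.4319 — 3 statements merged into one kernel-verified Lean document; each statement's English description precedes it below -/
import Mathlib

section
/- If F is a connected graph with chromatic number r+1, every vertex of F is critical (i.e., removing it reduces the chromatic number to r), and every vertex of F has degree r, then F is isomorphic to K_{r+1} or r = 2 and F is an odd cycle. -/
namespace SimpleGraph

variable {V : Type*} {G : SimpleGraph V} {r : ℕ}

/-- The map `c` restricts to a proper coloring of the subgraph induced on `S`. -/
def IsProperOn (G : SimpleGraph V) {α : Type*} (c : V → α) (S : Set V) : Prop :=
  ∀ ⦃u⦄, u ∈ S → ∀ ⦃w⦄, w ∈ S → G.Adj u w → c u ≠ c w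

theorem IsProperOn.mono {α : Type*} {c : V → α} {S T : Set V} (h : G.IsProperOn c T)
    (hST : S ⊆ T) : G.IsProperOn c S :=
  fun _ hu _ hw => h (hST hu) (hST hw)

theorem IsProperOn.colorable {c : V → Fin r} {S : Set V} (h : G.IsProperOn c S)
    (hS : ∀ v, v ∈ S) : G.Colorable r :=
  ⟨Coloring.mk c fun {u w} huw => h (hS u) (hS w) huw⟩

theorem IsProperOn.exists_insert {α : Type*} {c : V → α} {S : Set V} (h : G.IsProperOn c S)
    {v : V} (hv : v ∉ S) {a : α} (ha : ∀ u ∈ S, G.Adj v u → c u ≠ a) :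
    ∃ c' : V → α, Set.EqOn c' c S ∧ c' v = a ∧ G.IsProperOn c' (insert v S) := by
  classical
  have hne : ∀ u ∈ S, u ≠ v := fun u hu => ne_of_mem_of_not_mem hu hv
  refine ⟨Function.update c v a, fun u hu => Function.update_of_ne (hne u hu) .., by simp, ?_⟩
  rintro u (rfl | hu) w (rfl | hw) huw
  · exact absurd huw G.irrefl
  · simpa [hne w hw] using (ha w hw huw).symm
  · simpa [hne u hu] using ha u hu huw.symm
  · simpa [hne u hu, hne w hw] using h hu hw huw

theorem isChain_adj_reverse {l : List V} : l.reverse.IsChain G.Adj ↔ l.IsChain G.Adj := by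
  have h : (fun a b => G.Adj b a) = G.Adj := by
    ext a b
    exact G.adj_comm b a
  rw [List.isChain_reverse, h]

/-- A vertex of degree at most `r` has a free color if some neighbor is uncolored or shares its
color with another one. -/
theorem exists_free_color [Fintype V] [DecidableRel G.Adj] {v w : V} (hdeg : G.degree v ≤ r)
    (c : V → Fin r) (S : Set V) (hvw : G.Adj v w)
    (hw : w ∈ S → ∃ q ≠ w, G.Adj v q ∧ c q = c w) :
    ∃ a, ∀ u ∈ S, G.Adj v u → c u ≠ a := by
  classical
  have hcard : (((G.neighborFinset v).erase w).image c).card <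
      (Finset.univ : Finset (Fin r)).card := by
    have h1 := Finset.card_image_le (s := (G.neighborFinset v).erase w) (f := c)
    have h2 := Finset.card_erase_lt_of_mem ((G.mem_neighborFinset v w).2 hvw)
    rw [card_neighborFinset_eq_degree] at h2
    simp only [Finset.card_univ, Fintype.card_fin]
    omega
  obtain ⟨a, -, ha⟩ := Finset.exists_mem_notMem_of_card_lt_card hcard
  refine ⟨a, fun u hu huv hua => ha ?_⟩
  by_cases huw : u = w
  · subst huw
    obtain ⟨q, hq, hvq, hcq⟩ := hw hu
    exact Finset.mem_image.2 ⟨q, by simp [hq, hvq], hcq.trans hua⟩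
  · exact Finset.mem_image.2 ⟨u, by simp [huw, huv], hua⟩

/-- Greedy coloring along a path, leaving its last vertex uncolored. -/
theorem IsProperOn.exists_extend_path [Fintype V] [DecidableRel G.Adj]
    (hdeg : ∀ v, G.degree v ≤ r) (l : List V) {z : V} {c : V → Fin r} {S : Set V}
    (h : G.IsProperOn c S) (hl : (l ++ [z]).IsChain G.Adj) (hnd : (l ++ [z]).Nodup)
    (hS : ∀ v ∈ l ++ [z], v ∉ S) :
    ∃ c' : V → Fin r, Set.EqOn c' c S ∧ G.IsProperOn c' (S ∪ {v | v ∈ l}) := by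
  induction l generalizing c S with
  | nil => exact ⟨c, fun _ _ => rfl, by simpa using h⟩
  | cons a l ih =>
    obtain ⟨b, t, hbt⟩ : ∃ b t, l ++ [z] = b :: t := by cases l <;> simp
    rw [List.cons_append, hbt, List.isChain_cons_cons, ← hbt] at hl
    have hbS : b ∉ S := hS b (by simp [hbt])
    obtain ⟨x, hx⟩ := exists_free_color (hdeg a) c S hl.1 fun hb => absurd hb hbS
    obtain ⟨c₁, hc₁, -, hp₁⟩ := h.exists_insert (hS a (by simp)) hx
    rw [List.cons_append, List.nodup_cons] at hnd
    obtain ⟨c₂, hc₂, hp₂⟩ := ih hp₁ hl.2 hnd.2 fun v hv => by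
      rintro (rfl | hvS)
      · exact hnd.1 hv
      · exact hS v (List.mem_cons_of_mem _ hv) hvS
    refine ⟨c₂, fun v hv => (hc₂ (Or.inr hv)).trans (hc₁ hv), hp₂.mono ?_⟩
    intro v
    simp only [Set.mem_union, Set.mem_ofPred_eq, List.mem_cons, Set.mem_insert_iff]
    tauto

/-- Greedy coloring along a path whose last vertex has two neighbors of the same color. -/
theorem IsProperOn.exists_extend_path_of_eq [Fintype V] [DecidableRel G.Adj]
    (hdeg : ∀ v, G.degree v ≤ r) (l : List V) {z p q : V} {c : V → Fin r} {S : Set V}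
    (h : G.IsProperOn c S) (hl : (l ++ [z]).IsChain G.Adj) (hnd : (l ++ [z]).Nodup)
    (hS : ∀ v ∈ l ++ [z], v ∉ S) (hp : p ∈ S) (hq : q ∈ S) (hpq : p ≠ q)
    (hzp : G.Adj z p) (hzq : G.Adj z q) (hc : c p = c q) :
    ∃ c' : V → Fin r, G.IsProperOn c' (S ∪ {v | v ∈ l ++ [z]}) := by
  obtain ⟨c₁, hc₁, hp₁⟩ := h.exists_extend_path hdeg l hl hnd hS
  have hz : z ∉ S ∪ {v | v ∈ l} := by
    rintro (hz | hz)
    · exact hS z (by simp) hz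
    · exact List.disjoint_of_nodup_append hnd hz (by simp)
  obtain ⟨a, ha⟩ := exists_free_color (hdeg z) c₁ (S ∪ {v | v ∈ l}) hzp
    fun _ => ⟨q, hpq.symm, hzq, by rw [hc₁ hp, hc₁ hq, hc]⟩
  obtain ⟨c₂, -, -, hp₂⟩ := hp₁.exists_insert hz ha
  refine ⟨c₂, hp₂.mono ?_⟩
  intro v
  simp only [Set.mem_union, Set.mem_ofPred_eq, List.mem_append, List.mem_singleton,
    Set.mem_insert_iff]
  tauto

/-- In a connected vertex-critical graph of maximum degree at most `r` that is not
`r`-colorable, a cycle containing all neighbors of its first vertex is spanning. -/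
theorem Connected.mem_of_cycle_of_critical [Fintype V] [DecidableRel G.Adj] (hconn : G.Connected)
    (hdeg : ∀ v, G.degree v ≤ r) (hG : ¬ G.Colorable r)
    (hcrit : ∀ v, ∃ c : V → Fin r, G.IsProperOn c {v}ᶜ)
    {C : List V} (hl : C.IsChain G.Adj) (hnd : C.Nodup) {y t : V} (hyC : y ∈ C.head?)
    (htC : t ∈ C.getLast?) (hy : ∀ u, G.Adj y u → u ∈ C) (hyt : G.Adj y t) (v : V) :
    v ∈ C := by
  classical
  by_contra hv
  obtain ⟨w⟩ := hconn.preconnected y v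
  obtain ⟨d, -, hd₁, hd₂⟩ := w.exists_boundary_dart {x | x ∈ C} (List.mem_of_mem_head? hyC) hv
  -- the first vertex of the cycle with a neighbor outside
  obtain ⟨A, z, B, rfl, ⟨u, hzu, hu⟩, hA⟩ : ∃ A z B, C = A ++ z :: B ∧
      (∃ u, G.Adj z u ∧ u ∉ C) ∧ ∀ a ∈ A, ¬ ∃ u, G.Adj a u ∧ u ∉ C := by
    have hsome : (C.find? fun a => ∃ u, G.Adj a u ∧ u ∉ C).isSome := by
      rw [List.find?_isSome]
      exact ⟨d.fst, hd₁, by simpa using ⟨d.snd, d.adj, by simpa using hd₂⟩⟩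
    obtain ⟨z, hz⟩ := Option.isSome_iff_exists.1 hsome
    obtain ⟨h₁, A, B, h₂, h₃⟩ := List.find?_eq_some_iff_append.1 hz
    refine ⟨A, z, B, h₂, of_decide_eq_true h₁, fun a ha => ?_⟩
    have := h₃ a ha
    rw [Bool.not_eq_true', decide_eq_false_iff_not] at this
    exact this
  rcases A.eq_nil_or_concat' with rfl | ⟨A, x, rfl⟩
  · obtain rfl : z = y := by simpa using hyC
    exact hu (hy u hzu)
  have hxC : x ∈ A ++ [x] ++ z :: B := by simp
  obtain ⟨c, hc⟩ := hcrit x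
  have hmono : {v | v ∉ A ++ [x] ++ z :: B} ⊆ ({x}ᶜ : Set V) := by
    rintro v hv rfl
    exact hv hxC
  obtain ⟨c₁, hc₁, hx₁, hp₁⟩ := (hc.mono hmono).exists_insert (v := x) (fun h => h hxC)
    (a := c u) fun w hw hxw => (hA x (by simp) ⟨w, hxw, hw⟩).elim
  have hperm : (A.reverse ++ B.reverse ++ [z]).Perm (A ++ z :: B) := by
    refine ((A.reverse_perm.append B.reverse_perm).append_right [z]).trans ?_
    rw [List.append_assoc]
    exact List.Perm.append_left A (List.perm_append_singleton z B)
  have hperm' : (A ++ [x] ++ z :: B).Perm (x :: (A ++ z :: B)) := by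
    rw [List.append_assoc]
    exact List.perm_middle
  have hnd' := hperm'.nodup_iff.1 hnd
  rw [List.nodup_cons] at hnd'
  have hchain : (A.reverse ++ B.reverse ++ [z]).IsChain G.Adj := by
    have hrev : A.reverse ++ B.reverse ++ [z] = (z :: B ++ A).reverse := by simp
    rw [hrev, isChain_adj_reverse, List.isChain_append]
    rw [List.append_assoc] at hl
    refine ⟨(List.isChain_append.1 (List.isChain_append.1 hl).2.1).2.1,
      (List.isChain_append.1 hl).1, fun a ha b hb => ?_⟩
    obtain rfl : a = t := by
      rw [List.getLast?_append_of_ne_nil _ (List.cons_ne_nil z B)] at htC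
      exact Option.mem_unique ha htC
    obtain rfl : b = y := by
      rw [List.append_assoc] at hyC
      exact Option.mem_unique (List.mem_head?_append_of_mem_head? hb) hyC
    exact hyt.symm
  obtain ⟨c₂, hc₂⟩ := hp₁.exists_extend_path_of_eq hdeg (A.reverse ++ B.reverse) (z := z)
    hchain (hperm.nodup_iff.2 hnd'.2) (p := u) (q := x)
    (by
      intro v hv
      rw [hperm.mem_iff] at hv
      rintro (hvx | hvC)
      · exact hnd'.1 (hvx ▸ hv)
      · exact hvC (hperm'.mem_iff.2 (List.mem_cons_of_mem _ hv)))
    (Or.inr hu) (Or.inl rfl) (ne_of_mem_of_not_mem hxC hu).symm hzu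
    (by
      rw [List.append_assoc, List.singleton_append, List.isChain_append_cons_cons] at hl
      exact hl.2.1.symm)
    (by rw [hx₁, hc₁ hu])
  refine hG (hc₂.colorable fun v => ?_)
  by_cases hv : v ∈ A ++ [x] ++ z :: B
  · rw [hperm'.mem_iff, List.mem_cons, ← hperm.mem_iff] at hv
    exact hv.elim (fun h => Or.inl (Or.inl h)) Or.inr
  · exact Or.inl (Or.inr hv)

/-- A path in a finite graph extends to a path with no neighbors of its first vertex outside. -/
theorem exists_maximal_path [Fintype V] {l : List V} (hl : l.IsChain G.Adj) (hnd : l.Nodup)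
    (hne : l ≠ []) : ∃ y m, l <:+ y :: m ∧ (y :: m).IsChain G.Adj ∧ (y :: m).Nodup ∧
      ∀ u, G.Adj y u → u ∈ m := by
  induction hk : Fintype.card V - l.length generalizing l with
  | zero =>
    obtain ⟨y, m, rfl⟩ := List.exists_cons_of_ne_nil hne
    refine ⟨y, m, List.suffix_rfl, hl, hnd, fun u hyu => ?_⟩
    by_contra hu
    have := List.Nodup.length_le_card (l := u :: y :: m)
      (List.nodup_cons.2 ⟨by simp [hyu.ne', hu], hnd⟩)
    simp only [List.length_cons] at this hk
    omega
  | succ k ih =>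
    obtain ⟨y, m, rfl⟩ := List.exists_cons_of_ne_nil hne
    by_cases h : ∀ u, G.Adj y u → u ∈ m
    · exact ⟨y, m, List.suffix_rfl, hl, hnd, h⟩
    · push Not at h
      obtain ⟨u, hyu, hu⟩ := h
      obtain ⟨y', m', hs, hmax⟩ := ih (l := u :: y :: m)
        (List.isChain_cons_cons.2 ⟨hyu.symm, hl⟩)
        (List.nodup_cons.2 ⟨by simp [hyu.ne', hu], hnd⟩) (List.cons_ne_nil _ _)
        (by simp only [List.length_cons] at hk ⊢; omega)
      exact ⟨y', m', (List.suffix_cons u _).trans hs, hmax⟩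

/-- In a connected vertex-critical graph of maximum degree at most `r` that is not
`r`-colorable, every path extends to a Hamiltonian path with an initial segment closing to
a Hamiltonian cycle. -/
theorem Connected.exists_spanning_cycle_of_critical [Fintype V] [DecidableRel G.Adj]
    (hconn : G.Connected)
    (hdeg : ∀ v, G.degree v ≤ r) (hG : ¬ G.Colorable r)
    (hcrit : ∀ v, ∃ c : V → Fin r, G.IsProperOn c {v}ᶜ)
    {l : List V} (hl : l.IsChain G.Adj) (hnd : l.Nodup) (hlen : 2 ≤ l.length) :
    ∃ m y t, l <:+ m ∧ m.IsChain G.Adj ∧ m.Nodup ∧ (∀ v, v ∈ m) ∧ y ∈ m.head? ∧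
      t ∈ m.getLast? ∧ G.Adj y t := by
  classical
  obtain ⟨y, m, hlm, hm, hmnd, hym⟩ :=
    exists_maximal_path hl hnd (List.ne_nil_of_length_pos (by omega))
  -- the last neighbor of the first vertex
  obtain ⟨t, D, E, hDE, hyt, hE⟩ : ∃ t D E, y :: m = D ++ t :: E ∧ G.Adj y t ∧
      ∀ e ∈ E, ¬ G.Adj y e := by
    have hsome : ((y :: m).reverse.find? fun a => G.Adj y a).isSome := by
      rw [List.find?_isSome]
      have := hlm.length_le
      obtain _ | ⟨a, m⟩ := m
      · simp only [List.length_cons, List.length_nil] at this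
        omega
      · exact ⟨a, by simp, by simpa using (List.isChain_cons_cons.1 hm).1⟩
    obtain ⟨t, ht⟩ := Option.isSome_iff_exists.1 hsome
    obtain ⟨h₁, A, B, h₂, h₃⟩ := List.find?_eq_some_iff_append.1 ht
    refine ⟨t, B.reverse, A.reverse, ?_, of_decide_eq_true h₁, fun e he => ?_⟩
    · rw [← List.reverse_inj, h₂]
      simp
    · simpa using h₃ e (List.mem_reverse.1 he)
  have hDE' : y :: m = D ++ [t] ++ E := by rw [hDE]; simp
  have hyD : y ∈ (D ++ [t]).head? := by
    cases D with
    | nil =>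
      obtain ⟨rfl, -⟩ := by simpa using hDE
      exact absurd hyt G.irrefl
    | cons d D =>
      obtain ⟨rfl, -⟩ := by simpa using hDE
      simp
  have hnd' := hmnd
  have hm' := hm
  rw [hDE'] at hnd' hm'
  have hspan := hconn.mem_of_cycle_of_critical hdeg hG hcrit (List.isChain_append.1 hm').1
    (List.nodup_append.1 hnd').1 hyD (t := t) (by simp)
    (fun u hu => by
      have hmem := List.mem_cons_of_mem y (hym u hu)
      rw [hDE', List.mem_append] at hmem
      exact hmem.resolve_right fun h => hE u h hu) hyt
  obtain rfl : E = [] := List.eq_nil_iff_forall_not_mem.2 fun e he =>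
    List.disjoint_of_nodup_append hnd' (hspan e) he
  rw [List.append_nil] at hDE'
  exact ⟨y :: m, y, t, hlm, hm, hmnd, fun v => hDE' ▸ hspan v, rfl, by rw [hDE']; simp, hyt⟩

/-- A 2-regular graph with a Hamiltonian cycle is a cycle graph. -/
theorem nonempty_iso_cycleGraph [Fintype V] [DecidableRel G.Adj] (hdeg : ∀ v, G.degree v = 2)
    {C : List V} (hl : C.IsChain G.Adj) (hnd : C.Nodup) {y t : V} (hyC : y ∈ C.head?)
    (htC : t ∈ C.getLast?) (hyt : G.Adj y t) (hC : ∀ v, v ∈ C) :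
    ∃ n, 3 ≤ n ∧ Nonempty (G ≃g cycleGraph n) := by
  classical
  have hbij : Function.Bijective C.get :=
    ⟨List.nodup_iff_injective_get.1 hnd, fun v => List.mem_iff_get.1 (hC v)⟩
  have hcard : Fintype.card V = C.length := by
    simpa using (Fintype.card_of_bijective hbij).symm
  have h3 : 3 ≤ C.length := by
    have := G.degree_lt_card_verts y
    rw [hdeg] at this
    omega
  have hstep : ∀ u v : Fin C.length, (u - v).val = 1 → G.Adj (C.get v) (C.get u) := by
    intro u v huv
    have hu := u.2
    have hv := v.2
    rw [Fin.val_sub] at huv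
    by_cases hv' : v.val + 1 < C.length
    · obtain hu' : u.val = v.val + 1 := by
        rcases Nat.lt_or_ge (C.length - v + u) C.length with h | h
        · rw [Nat.mod_eq_of_lt h] at huv
          omega
        · rw [Nat.mod_eq_sub_mod h, Nat.mod_eq_of_lt (by omega)] at huv
          omega
      have := List.isChain_iff_getElem.1 hl v hv'
      simpa [hu'] using this
    · have hv'' : v.val = C.length - 1 := by omega
      have hu' : u.val = 0 := by
        rcases Nat.lt_or_ge (C.length - v + u) C.length with h | h
        · rw [Nat.mod_eq_of_lt h] at huv
          omega
        · rw [Nat.mod_eq_sub_mod h, Nat.mod_eq_of_lt (by omega)] at huv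
          omega
      have hyu : C[0]'(by omega) = y := by
        rw [Option.mem_def, List.head?_eq_getElem?] at hyC
        exact (List.getElem?_eq_some_iff.1 hyC).2
      have htv : C[C.length - 1]'(by omega) = t := by
        rw [Option.mem_def, List.getLast?_eq_getElem?] at htC
        exact (List.getElem?_eq_some_iff.1 htC).2
      simpa [hu', hv'', hyu, htv] using hyt.symm
  have hhom : ∀ u v : Fin C.length, (cycleGraph C.length).Adj u v →
      G.Adj (C.get u) (C.get v) := by
    intro u v huv
    rcases cycleGraph_adj'.1 huv with h | h
    · exact (hstep u v h).symm
    · exact hstep v u h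
  refine ⟨C.length, h3, ⟨RelIso.symm
    ⟨Equiv.ofBijective _ hbij, fun {u v} => ⟨fun h => ?_, hhom u v⟩⟩⟩⟩
  have hcdeg : (cycleGraph C.length).degree u = 2 := by
    have key : ∀ n, 3 ≤ n → ∀ w : Fin n, (cycleGraph n).degree w = 2 := by
      rintro n hn w
      obtain ⟨k, rfl⟩ := Nat.exists_eq_add_of_le' hn
      exact cycleGraph_degree_three_le
    exact key _ h3 u
  have heq : ((cycleGraph C.length).neighborFinset u).image C.get =
      G.neighborFinset (C.get u) := by
    refine Finset.eq_of_subset_of_card_le (fun x hx => ?_) ?_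
    · obtain ⟨w, hw, rfl⟩ := Finset.mem_image.1 hx
      exact (G.mem_neighborFinset _ _).2 (hhom u w ((mem_neighborFinset _ _ _).1 hw))
    · rw [Finset.card_image_of_injective _ hbij.1, card_neighborFinset_eq_degree,
        card_neighborFinset_eq_degree, hcdeg, hdeg]
  have hmem := (G.mem_neighborFinset _ _).2 h
  rw [Equiv.ofBijective_apply, Equiv.ofBijective_apply, ← heq] at hmem
  obtain ⟨w, hw, hwv⟩ := Finset.mem_image.1 hmem
  exact hbij.1 hwv ▸ (mem_neighborFinset _ _ _).1 hw

theorem Connected.exists_adj_adj_not_adj (hconn : G.Connected) (hG : G ≠ ⊤) :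
    ∃ a b c, G.Adj a b ∧ G.Adj b c ∧ a ≠ c ∧ ¬ G.Adj a c := by
  by_contra! h
  refine hG (eq_top_iff.2 fun a b hab => ?_)
  obtain ⟨w⟩ := hconn.preconnected a b
  induction w with
  | nil => exact absurd rfl hab
  | @cons a x b hax w ih =>
    by_cases hxb : x = b
    · exact hxb ▸ hax
    · exact h a x b hax (ih hxb) hab

end SimpleGraph


/-- If `F` is a connected graph with chromatic number `r+1`, every vertex of `F` is
critical (removing it drops the chromatic number to `r`), and every vertex has degree `r`,
then `F` is isomorphic to `K_{r+1}`, or `r = 2` and `F` is an odd cycle. -/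
theorem connected_critical_regular_iff {V : Type*} [Fintype V] (r : ℕ)
    (F : SimpleGraph V) [DecidableRel F.Adj]
    (hconn : F.Connected)
    (hchrom : F.chromaticNumber = (r + 1 : ℕ))
    (hcrit : ∀ v : V, (F.induce {v}ᶜ).chromaticNumber = (r : ℕ))
    (hdeg : ∀ v : V, F.degree v = r) :
    Nonempty (F ≃g (⊤ : SimpleGraph (Fin (r + 1)))) ∨
      (r = 2 ∧ ∃ k : ℕ, 1 ≤ k ∧ Nonempty (F ≃g SimpleGraph.cycleGraph (2 * k + 1))) := by
  classical
  have hdeg' : ∀ v, F.degree v ≤ r := fun v => (hdeg v).le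
  have hcol : ¬ F.Colorable r := fun h => by
    have := h.chromaticNumber_le
    rw [hchrom, Nat.cast_le] at this
    omega
  by_cases htop : F = ⊤
  · subst htop
    left
    obtain ⟨v⟩ := hconn.nonempty
    have hcard : Fintype.card V = r + 1 := by
      have h1 : Fintype.card V - 1 = r :=
        (SimpleGraph.complete_graph_degree v).symm.trans (by convert hdeg v)
      have h2 : 0 < Fintype.card V := Fintype.card_pos_iff.2 ⟨v⟩
      omega
    exact ⟨SimpleGraph.Iso.completeGraph (Fintype.equivFinOfCardEq hcard)⟩
  obtain ⟨a, b, c, hab, hbc, hac, hnac⟩ := hconn.exists_adj_adj_not_adj htop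
  have hr2 : 2 ≤ r := by
    rw [← hdeg b, ← F.card_neighborFinset_eq_degree, ← Finset.card_pair hac]
    exact Finset.card_le_card (by simp [Finset.insert_subset_iff, hab.symm, hbc])
  have hcrit' : ∀ v, ∃ c : V → Fin r, F.IsProperOn c {v}ᶜ := by
    intro v
    obtain ⟨c⟩ := SimpleGraph.chromaticNumber_le_iff_colorable.1 (hcrit v).le
    refine ⟨fun u => if hu : u ∈ ({v}ᶜ : Set V) then c ⟨u, hu⟩ else ⟨0, by omega⟩, ?_⟩
    intro u hu w hw huw
    simp only [dif_pos hu, dif_pos hw]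
    exact c.valid (SimpleGraph.induce_adj.2 huw)
  obtain ⟨m, y, t, ⟨T, rfl⟩, hm, hmnd, hspan, hy, ht, hyt⟩ :=
    hconn.exists_spanning_cycle_of_critical hdeg' hcol hcrit' (l := [a, b, c])
      (by simp [hab, hbc]) (by simp [hab.ne, hbc.ne, hac]) (by simp)
  obtain rfl | hr3 := hr2.eq_or_lt
  · right
    refine ⟨rfl, ?_⟩
    obtain ⟨n, hn, ⟨e⟩⟩ := SimpleGraph.nonempty_iso_cycleGraph hdeg hm hmnd hy ht hyt hspan
    rcases n.even_or_odd with heven | ⟨k, rfl⟩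
    · exfalso
      have := SimpleGraph.chromaticNumber_cycleGraph_of_even n (by omega) heven
      exact hcol ((SimpleGraph.chromaticNumber_le_iff_colorable.1 this.le).of_hom e.toHom)
    · exact ⟨k, by omega, ⟨e⟩⟩
  -- for `3 ≤ r`, color `a` and `c` alike and go greedily around the cycle, ending in `b`
  exfalso
  obtain ⟨x, hx, hxac⟩ : ∃ x ∈ F.neighborFinset b, x ∉ ({a, c} : Finset V) :=
    Finset.exists_mem_notMem_of_card_lt_card (by
      rwa [F.card_neighborFinset_eq_degree, hdeg, Finset.card_pair hac])
  rw [F.mem_neighborFinset] at hx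
  simp only [Finset.mem_insert, Finset.mem_singleton, not_or] at hxac
  have hxT : x ∈ T := by simpa [hxac, hx.ne'] using hspan x
  obtain ⟨B, A, rfl⟩ := List.append_of_mem hxT
  have hp : F.IsProperOn (fun _ => (⟨0, by omega⟩ : Fin r)) {a, c} := by
    rintro u (rfl | rfl) w (rfl | rfl) huw
    · exact absurd huw F.irrefl
    · exact absurd huw hnac
    · exact absurd huw.symm hnac
    · exact absurd huw F.irrefl
  rw [List.append_assoc, List.cons_append] at hm hmnd
  have hm₁ : (A.reverse ++ [x]).IsChain F.Adj := by
    rw [← List.reverse_cons, SimpleGraph.isChain_adj_reverse]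
    exact (List.isChain_append.1 (List.isChain_append.1 hm).2.1).1
  have hm₂ : (B ++ [x] ++ [b]).IsChain F.Adj :=
    List.isChain_append.2 ⟨(List.isChain_split.1 hm).1, by simp, by simpa using hx.symm⟩
  have hnd₁ : (A.reverse ++ [x]).Nodup := by
    rw [← List.reverse_cons, List.nodup_reverse]
    exact hmnd.sublist
      (((List.sublist_append_left A [a, b, c]).cons_cons x).trans (List.sublist_append_right B _))
  have hnd₂ : (B ++ [x] ++ [b]).Nodup := by
    rw [List.append_assoc]
    refine hmnd.sublist ((List.Sublist.cons_cons x ?_).append_left B)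
    simp
  simp only [List.nodup_append, List.nodup_cons, List.mem_append, List.mem_cons,
    List.not_mem_nil, or_false, not_or] at hmnd
  obtain ⟨-, ⟨hxA, -, -, hA⟩, hB⟩ := hmnd
  obtain ⟨c₁, hc₁, hp₁⟩ := hp.exists_extend_path hdeg' A.reverse hm₁ hnd₁ (by
    simp only [List.mem_append, List.mem_reverse, List.mem_singleton, Set.mem_insert_iff,
      Set.mem_singleton_iff, not_or]
    rintro v (hv | rfl)
    · exact ⟨hA v hv a (by simp), hA v hv c (by simp)⟩
    · exact hxac)
  obtain ⟨c₂, hc₂⟩ := hp₁.exists_extend_path_of_eq hdeg' (B ++ [x]) hm₂ hnd₂ (by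
    simp only [List.mem_append, List.mem_reverse, List.mem_singleton, Set.mem_insert_iff,
      Set.mem_singleton_iff, Set.mem_union, Set.mem_ofPred_eq, not_or]
    rintro v ((hv | rfl) | rfl)
    · exact ⟨⟨hB v hv a (by simp), hB v hv c (by simp)⟩,
        fun hvA => hB v hv v (by simp [hvA]) rfl⟩
    · exact ⟨hxac, hxA.1⟩
    · exact ⟨⟨hab.ne', hbc.ne⟩, fun hvA => hA v hvA v (by simp) rfl⟩)
    (p := a) (q := c) (by simp) (by simp) hac hab.symm hbc
    (by rw [hc₁ (by simp), hc₁ (by simp)])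
  refine hcol (hc₂.colorable fun v => ?_)
  have := hspan v
  simp only [List.mem_append, List.mem_cons, List.not_mem_nil, Set.mem_union, Set.mem_insert_iff,
    Set.mem_singleton_iff, Set.mem_ofPred_eq, List.mem_reverse] at this ⊢
  tauto
end

section
/- Let F be a connected r-critical graph (χ(F) = r+1 and some edge e has χ(F−e) = r). If every critical vertex of F has degree at most r, then F = K_{r+1}, or r = 2 and F is an odd cycle. -/
namespace SimpleGraph

variable {V : Type*} {G : SimpleGraph V} {r : ℕ}

/-- `c` assigns different colors to adjacent vertices as long as both lie outside `S`. -/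
def IsProperOff (G : SimpleGraph V) (c : V → Fin r) (S : Finset V) : Prop :=
  ∀ u w, u ∉ S → w ∉ S → G.Adj u w → c u ≠ c w

lemma exists_color_notMem (c : V → Fin r) (T : Finset V) (hT : T.card < r) :
    ∃ k, ∀ t ∈ T, c t ≠ k := by
  classical
  have h : (T.image c).card < (Finset.univ : Finset (Fin r)).card := by
    simpa using Finset.card_image_le.trans_lt hT
  obtain ⟨k, -, hk⟩ := Finset.exists_mem_notMem_of_card_lt_card h
  exact ⟨k, fun t ht e => hk (Finset.mem_image.2 ⟨t, ht, e⟩)⟩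

lemma IsProperOff.update [DecidableEq V] {c : V → Fin r} {S T : Finset V} {u : V} {k : Fin r}
    (hc : G.IsProperOff c S) (hST : S ⊆ insert u T)
    (hk : ∀ w, w ∉ T → w ≠ u → G.Adj u w → c w ≠ k) :
    G.IsProperOff (Function.update c u k) T := by
  intro a b ha hb hab
  have key : ∀ t, t ∉ T → t ≠ u → t ∉ S := fun t ht htu hS => by
    rcases Finset.mem_insert.1 (hST hS) with h | h
    exacts [htu h, ht h]
  by_cases hau : a = u
  · subst hau
    have hba : b ≠ a := hab.ne'
    simpa [Function.update_of_ne hba] using (hk b hb hba hab).symm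
  · by_cases hbu : b = u
    · subst hbu
      simpa [Function.update_of_ne hau] using hk a ha hau hab.symm
    · simpa [Function.update_of_ne hau, Function.update_of_ne hbu]
        using hc a b (key a ha hau) (key b hb hbu) hab

lemma IsProperOff.colorable {c : V → Fin r} (hc : G.IsProperOff c ∅) : G.Colorable r :=
  ⟨Coloring.mk c fun {u w} h => hc u w (by simp) (by simp) h⟩

/-- An injective path on the indices below `n`. -/
def IsPathSeq (G : SimpleGraph V) (x : ℕ → V) (n : ℕ) : Prop :=
  (∀ i j, i < n → j < n → x i = x j → i = j) ∧ ∀ i, i + 1 < n → G.Adj (x i) (x (i + 1))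

/-- Every induced path on three vertices extends to a path whose last vertex has all its neighbors
on the path. -/
lemma exists_maximal_isPathSeq [Fintype V] {a b c : V} (hab : G.Adj a b) (hbc : G.Adj b c) (hac : a ≠ c) :
    ∃ x n, G.IsPathSeq x n ∧ 3 ≤ n ∧ x 0 = a ∧ x 1 = b ∧ x 2 = c ∧
      ∀ w, G.Adj (x (n - 1)) w → ∃ i < n, x i = w := by
  classical
  let P : ℕ → Prop := fun n => 3 ≤ n ∧ ∃ x, G.IsPathSeq x n ∧ x 0 = a ∧ x 1 = b ∧ x 2 = c
  have hP3 : P 3 := by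
    refine ⟨le_rfl, fun i => if i = 0 then a else if i = 1 then b else c, ⟨?_, ?_⟩, by simp,
      by simp, by simp⟩
    · intro i j hi hj
      interval_cases i <;> interval_cases j <;>
        simp [hab.ne, hbc.ne, hac, hab.ne', hbc.ne', hac.symm]
    · intro i hi
      have : i < 2 := by omega
      interval_cases i <;> simp [hab, hbc]
  have hle : ∀ n, P n → n ≤ Fintype.card V := by
    rintro n ⟨-, x, hx, -⟩
    have := Fintype.card_le_of_injective (fun i : Fin n => x i)
      (fun i j h => Fin.ext (hx.1 i j i.2 j.2 h))
    simpa using this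
  set n := Nat.findGreatest P (Fintype.card V) with hn
  obtain ⟨hn3, x, hx, h0, h1, h2⟩ : P n := Nat.findGreatest_spec (hle 3 hP3) hP3
  refine ⟨x, n, hx, hn3, h0, h1, h2, fun w hw => ?_⟩
  by_contra! hcon
  have hPs : P (n + 1) := by
    refine ⟨by omega, Function.update x n w, ⟨?_, ?_⟩, ?_, ?_, ?_⟩
    · intro i j hi hj h
      rcases Nat.lt_succ_iff_lt_or_eq.1 hi with hi | rfl <;>
        rcases Nat.lt_succ_iff_lt_or_eq.1 hj with hj | rfl
      · rw [Function.update_of_ne hi.ne, Function.update_of_ne hj.ne] at h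
        exact hx.1 i j hi hj h
      · rw [Function.update_of_ne hi.ne, Function.update_self] at h
        exact absurd h (hcon i hi)
      · rw [Function.update_of_ne hj.ne, Function.update_self] at h
        exact absurd h.symm (hcon j hj)
      · rfl
    · intro i hi
      rw [Function.update_of_ne (by omega : i ≠ n)]
      by_cases hin : i + 1 = n
      · rw [hin, Function.update_self]
        rwa [← hin, Nat.add_sub_cancel] at hw
      · rw [Function.update_of_ne hin]
        exact hx.2 i (by omega)
    all_goals rwa [Function.update_of_ne (by omega)]
  have := Nat.le_findGreatest (hle _ hPs) hPs
  omega

lemma IsPathSeq.exists_index {x : ℕ → V} {n : ℕ} (hx : G.IsPathSeq x n) :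
    ∃ idx : V → ℕ, ∀ i < n, idx (x i) = i := by
  classical
  refine ⟨fun v => if h : ∃ i < n, x i = v then h.choose else 0, fun i hi => ?_⟩
  have h : ∃ j < n, x j = x i := ⟨i, hi, rfl⟩
  simp only [dif_pos h]
  exact hx.1 _ _ h.choose_spec.1 hi h.choose_spec.2

lemma Colorable.of_induce_compl_singleton {v : V} {m : ℕ} (h : (G.induce {v}ᶜ).Colorable m) :
    G.Colorable (m + 1) := by
  classical
  obtain ⟨c⟩ := h
  refine ⟨Coloring.mk (fun u => if hu : u = v then Fin.last m else
    (c ⟨u, by simpa using hu⟩).castSucc) fun {u w} huw => ?_⟩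
  by_cases hu : u = v
  · have hw : w ≠ v := fun h => huw.ne (hu.trans h.symm)
    simp [hu, hw, (Fin.castSucc_lt_last _).ne']
  · by_cases hw : w = v
    · simp [hu, hw]
    · simp only [hu, hw, dite_false]
      exact fun e => c.valid (v := ⟨u, by simpa using hu⟩) (w := ⟨w, by simpa using hw⟩) huw
        (Fin.castSucc_injective _ e)

/-- A vertex whose complement is properly `r`-colored is critical. -/
lemma IsProperOff.chromaticNumber_induce_compl (hG : ¬ G.Colorable r)
    {c : V → Fin r} {v : V} (hc : G.IsProperOff c {v}) :
    (G.induce {v}ᶜ).chromaticNumber = (r : ℕ) := by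
  refine le_antisymm (chromaticNumber_le_iff_colorable.2
    ⟨Coloring.mk (fun u => c u) fun {u w} h => hc u w
      (fun e => u.2 (Finset.mem_singleton.1 e)) (fun e => w.2 (Finset.mem_singleton.1 e)) h⟩)
    (le_chromaticNumber_iff_colorable.2 fun m hm => ?_)
  by_contra! hlt
  exact hG (hm.of_induce_compl_singleton.mono hlt)

section Finite

variable [Fintype V] [DecidableRel G.Adj]

/-- Greedy coloring: if every vertex of `S` other than `v` has a neighbor in `S` of smaller rank,
then a coloring proper outside `S` can be changed on `S` so that it is proper away from `v`. -/
lemma IsProperOff.exists_extend (hdeg : ∀ v, G.degree v ≤ r) (d : V → ℕ) (v : V) :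
    ∀ (n : ℕ) (S : Finset V) (c : V → Fin r), S.card = n → v ∈ S →
      (∀ u ∈ S, u ≠ v → ∃ w ∈ S, G.Adj u w ∧ d w < d u) → G.IsProperOff c S →
      ∃ c' : V → Fin r, (∀ u ∉ S, c' u = c u) ∧ G.IsProperOff c' {v} := by
  classical
  intro n
  induction n with
  | zero =>
    intro S c h0 hv
    simp [Finset.card_eq_zero.1 h0] at hv
  | succ n ih =>
    intro S c hn hv hd hc
    by_cases hne : (S.erase v).Nonempty
    · obtain ⟨u, hu, hmax⟩ := (S.erase v).exists_max_image d hne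
      obtain ⟨huv, huS⟩ := Finset.mem_erase.1 hu
      obtain ⟨w, hwS, huw, -⟩ := hd u huS huv
      have hw : w ∈ G.neighborFinset u := by simpa using huw
      have hcard : ((G.neighborFinset u).erase w).card < r :=
        (Finset.card_erase_lt_of_mem hw).trans_le (by simpa using hdeg u)
      obtain ⟨k, hk⟩ := exists_color_notMem c _ hcard
      have hc1 : G.IsProperOff (Function.update c u k) (S.erase u) := by
        refine hc.update (by rw [Finset.insert_erase huS]) fun x hx hxu hux => hk x ?_
        refine Finset.mem_erase.2 ⟨?_, by simpa using hux⟩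
        rintro rfl
        exact hx (Finset.mem_erase.2 ⟨hxu, hwS⟩)
      obtain ⟨c', hc', hp⟩ := ih (S.erase u) _
        (by rw [Finset.card_erase_of_mem huS, hn]; rfl)
        (Finset.mem_erase.2 ⟨huv.symm, hv⟩)
        (fun x hx hxv => by
          obtain ⟨hxu, hxS⟩ := Finset.mem_erase.1 hx
          obtain ⟨y, hy, hxy, hlt⟩ := hd x hxS hxv
          refine ⟨y, Finset.mem_erase.2 ⟨?_, hy⟩, hxy, hlt⟩
          rintro rfl
          have := hmax x (Finset.mem_erase.2 ⟨hxv, hxS⟩)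
          omega) hc1
      refine ⟨c', fun x hx => ?_, hp⟩
      have hxu : x ≠ u := by rintro rfl; exact hx huS
      rw [hc' x fun h => hx (Finset.mem_of_mem_erase h), Function.update_of_ne hxu]
    · have hS : S = {v} := by
        rw [Finset.not_nonempty_iff_eq_empty] at hne
        rw [← Finset.insert_erase hv, hne, insert_empty_eq]
      subst hS
      exact ⟨c, fun _ _ => rfl, hc⟩

/-- If in addition `v` has two neighbors outside `S` of the same color, then `G` is colorable. -/
lemma IsProperOff.colorable_of_repeated (hdeg : ∀ v, G.degree v ≤ r) (d : V → ℕ) {v a b : V}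
    {S : Finset V} {c : V → Fin r} (hv : v ∈ S)
    (hd : ∀ u ∈ S, u ≠ v → ∃ w ∈ S, G.Adj u w ∧ d w < d u) (hc : G.IsProperOff c S)
    (ha : a ∉ S) (hb : b ∉ S) (hab : a ≠ b) (hva : G.Adj v a) (hvb : G.Adj v b)
    (he : c a = c b) : G.Colorable r := by
  classical
  obtain ⟨c', hc', hp⟩ := IsProperOff.exists_extend hdeg d v _ S c rfl hv hd hc
  have ha' : a ∈ G.neighborFinset v := by simpa using hva
  have hcard : ((G.neighborFinset v).erase a).card < r :=
    (Finset.card_erase_lt_of_mem ha').trans_le (by simpa using hdeg v)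
  obtain ⟨k, hk⟩ := exists_color_notMem c' _ hcard
  refine (hp.update (u := v) (k := k) (T := ∅) (by simp) fun w _ _ hvw => ?_).colorable
  by_cases hwa : w = a
  · subst hwa
    rw [hc' w ha, he, ← hc' b hb]
    exact hk b (Finset.mem_erase.2 ⟨hab.symm, by simpa using hvb⟩)
  · exact hk w (Finset.mem_erase.2 ⟨hwa, by simpa using hvw⟩)

/-- In a non-`r`-colorable graph, a vertex of degree at most `r` whose complement is properly
colored sees every color exactly once. -/
lemma IsProperOff.injOn_neighborFinset (hG : ¬ G.Colorable r) {c : V → Fin r} {v : V}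
    (hc : G.IsProperOff c {v}) (hdeg : G.degree v ≤ r) :
    Set.InjOn c (G.neighborFinset v) ∧ G.degree v = r := by
  classical
  have hsurj : (G.neighborFinset v).image c = Finset.univ := by
    by_contra h
    obtain ⟨k, hk⟩ : ∃ k, k ∉ (G.neighborFinset v).image c := by
      simpa [Finset.eq_univ_iff_forall] using h
    refine hG (hc.update (u := v) (k := k) (T := ∅) (by simp) fun w _ _ hvw e => ?_).colorable
    exact hk (Finset.mem_image.2 ⟨w, by simpa using hvw, e⟩)
  have h1 : ((G.neighborFinset v).image c).card = r := by rw [hsurj]; simp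
  have h2 : (G.neighborFinset v).card ≤ r := by simpa using hdeg
  have h3 := Finset.card_image_le (s := G.neighborFinset v) (f := c)
  refine ⟨Finset.card_image_iff.1 (by omega), ?_⟩
  rw [← card_neighborFinset_eq_degree]
  omega

/-- Moving the uncolored vertex to a neighbor. -/
lemma IsProperOff.exists_adj (hG : ¬ G.Colorable r) {c : V → Fin r} {v w : V}
    (hc : G.IsProperOff c {v}) (hdeg : G.degree v ≤ r) (hvw : G.Adj v w) :
    ∃ c' : V → Fin r, G.IsProperOff c' {w} := by
  classical
  refine ⟨_, hc.update (u := v) (k := c w) (T := {w}) (by simp) fun x hx _ hvx e => ?_⟩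
  exact hx (by simpa using
    (hc.injOn_neighborFinset hG hdeg).1 (by simpa using hvx) (by simpa using hvw) e)

/-- In a connected vertex-critical graph of small degree, a path whose last vertex has all its
neighbors on the path is Hamiltonian. -/
lemma IsPathSeq.hamiltonian (hG : ¬ G.Colorable r) (hconn : G.Connected)
    (hdeg : ∀ v, G.degree v ≤ r) (hcrit : ∀ v, ∃ c : V → Fin r, G.IsProperOff c {v})
    {x : ℕ → V} {n : ℕ} (hx : G.IsPathSeq x n) (hn : 2 ≤ n)
    (hlast : ∀ w, G.Adj (x (n - 1)) w → ∃ i < n, x i = w) (v : V) : ∃ i < n, x i = v := by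
  classical
  by_contra! hv
  have hex : ∃ j, j < n ∧ G.Adj (x (n - 1)) (x j) := by
    refine ⟨n - 2, by omega, ?_⟩
    have := hx.2 (n - 2) (by omega)
    rw [show n - 2 + 1 = n - 1 by omega] at this
    exact this.symm
  set j := Nat.find hex with hj
  obtain ⟨hjn, hjadj⟩ := Nat.find_spec hex
  rw [← hj] at hjn hjadj
  have hjmin : ∀ i, i < n → G.Adj (x (n - 1)) (x i) → j ≤ i :=
    fun i hi hadj => Nat.find_min' hex ⟨hi, hadj⟩
  have hj1 : j < n - 1 := by
    have : j ≠ n - 1 := fun h => by rw [h] at hjadj; exact G.loopless.irrefl _ hjadj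
    omega
  let C : Finset V := (Finset.Ico j n).image x
  have hC : ∀ u, u ∈ C ↔ ∃ i, (j ≤ i ∧ i < n) ∧ x i = u := by simp [C]
  let Q : ℕ → Prop := fun k => (j ≤ k ∧ k < n) ∧ ∃ w ∉ C, G.Adj (x k) w
  have hQ : ∃ k, Q k := by
    obtain ⟨p⟩ := hconn.preconnected (x j) v
    obtain ⟨d, -, hd1, hd2⟩ := p.exists_boundary_dart (C : Set V)
      (by simpa using (hC _).2 ⟨j, ⟨le_rfl, hjn⟩, rfl⟩)
      (by
        intro h
        obtain ⟨i, hi, e⟩ := (hC _).1 (by simpa using h)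
        exact hv i hi.2 e)
    obtain ⟨k, hk, e⟩ := (hC _).1 (by simpa using hd1)
    exact ⟨k, hk, d.snd, by simpa using hd2, e ▸ d.adj⟩
  set k := Nat.findGreatest Q n with hk
  obtain ⟨⟨hjk, hkn⟩, w, hwC, hkw⟩ : Q k := by
    obtain ⟨k', hk'⟩ := hQ
    exact Nat.findGreatest_spec hk'.1.2.le hk'
  have hkmax : ∀ i, Q i → i ≤ k := fun i hi => Nat.le_findGreatest hi.1.2.le hi
  have hk1 : k + 1 < n := by
    by_contra hcon
    have hkn1 : k = n - 1 := by omega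
    rw [hkn1] at hkw
    obtain ⟨i, hi, rfl⟩ := hlast w hkw
    exact hwC ((hC _).2 ⟨i, ⟨hjmin i hi hkw, hi⟩, rfl⟩)
  have hz : ∀ u, u ∉ C → ¬ G.Adj (x (k + 1)) u := fun u hu hadj => by
    have := hkmax (k + 1) ⟨⟨by omega, hk1⟩, u, hu, hadj⟩
    omega
  have hzC : x (k + 1) ∈ C := (hC _).2 ⟨k + 1, ⟨by omega, hk1⟩, rfl⟩
  obtain ⟨c, hc⟩ := hcrit (x (k + 1))
  have hc' : G.IsProperOff (Function.update c (x (k + 1)) (c w)) (C.erase (x (k + 1))) :=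
    hc.update (by simp) fun u hu hne hadj =>
      absurd hadj (hz u fun h => hu (Finset.mem_erase.2 ⟨hne, h⟩))
  have hwz : w ≠ x (k + 1) := by rintro rfl; exact hwC hzC
  have hS : ∀ i, j ≤ i → i < n → i ≠ k + 1 → x i ∈ C.erase (x (k + 1)) := fun i h1 h2 h3 =>
    Finset.mem_erase.2 ⟨fun e => h3 (hx.1 _ _ h2 hk1 e), (hC _).2 ⟨i, ⟨h1, h2⟩, rfl⟩⟩
  obtain ⟨idx, hidx⟩ := hx.exists_index
  refine hG (hc'.colorable_of_repeated hdeg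
    (fun u => if idx u ≤ k then k - idx u else n - idx u + k) (v := x k) (a := w)
    (b := x (k + 1)) (hS k hjk hkn (by omega)) ?_
    (fun h => hwC (Finset.mem_of_mem_erase h)) (by simp) hwz hkw (hx.2 k hk1) ?_)
  · intro u hu huk
    obtain ⟨huz, huC⟩ := Finset.mem_erase.1 hu
    obtain ⟨i, ⟨hji, hin⟩, rfl⟩ := (hC u).1 huC
    have hik : i ≠ k := fun h => huk (by rw [h])
    have hik1 : i ≠ k + 1 := fun h => huz (by rw [h])
    rcases Nat.lt_or_ge i k with hlt | hge
    · refine ⟨x (i + 1), hS _ (by omega) (by omega) (by omega), hx.2 i (by omega), ?_⟩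
      simp only [hidx i hin, hidx (i + 1) (by omega)]
      rw [if_pos (by omega), if_pos (by omega)]
      omega
    · by_cases hil : i = n - 1
      · refine ⟨x j, hS _ le_rfl hjn (by omega), by rw [hil]; exact hjadj, ?_⟩
        simp only [hidx i hin, hidx j hjn]
        rw [if_pos (by omega), if_neg (by omega)]
        omega
      · refine ⟨x (i + 1), hS _ (by omega) (by omega) (by omega), hx.2 i (by omega), ?_⟩
        simp only [hidx i hin, hidx (i + 1) (by omega)]
        rw [if_neg (by omega), if_neg (by omega)]
        omega
  · rw [Function.update_self, Function.update_of_ne hwz]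

/-- A graph with a Hamiltonian path starting with an induced path on three vertices whose middle
vertex has a further neighbor is greedily colorable. -/
lemma IsPathSeq.colorable_of_hamiltonian (hdeg : ∀ v, G.degree v ≤ r) (hr : 0 < r)
    {x : ℕ → V} {n : ℕ} (hx : G.IsPathSeq x n) (hn : 3 ≤ n) (hham : ∀ v, ∃ i < n, x i = v)
    (h02 : ¬ G.Adj (x 0) (x 2)) {j : ℕ} (hj : 3 ≤ j) (hjn : j < n)
    (h1j : G.Adj (x 1) (x j)) : G.Colorable r := by
  classical
  obtain ⟨idx, hidx⟩ := hx.exists_index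
  have hS : ∀ i, i < n → (x i ∈ ({x 0, x 2} : Finset V)ᶜ ↔ i ≠ 0 ∧ i ≠ 2) := fun i hi => by
    have h0 : x i = x 0 ↔ i = 0 := ⟨hx.1 _ _ hi (by omega), fun h => by rw [h]⟩
    have h2 : x i = x 2 ↔ i = 2 := ⟨hx.1 _ _ hi (by omega), fun h => by rw [h]⟩
    simp [h0, h2]
  have hc : G.IsProperOff (fun _ => (⟨0, hr⟩ : Fin r)) ({x 0, x 2} : Finset V)ᶜ := by
    intro u w hu hw huw
    simp only [Finset.mem_compl, Finset.mem_insert, Finset.mem_singleton, not_not] at hu hw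
    rcases hu with rfl | rfl <;> rcases hw with rfl | rfl
    · exact absurd huw (G.loopless.irrefl _)
    · exact absurd huw h02
    · exact absurd huw.symm h02
    · exact absurd huw (G.loopless.irrefl _)
  refine hc.colorable_of_repeated hdeg
    (fun u => if idx u = 1 then 0 else (idx u - j) + (j - idx u) + 1)
    (v := x 1) (a := x 0) (b := x 2) ((hS 1 (by omega)).2 (by omega)) ?_ (by simp) (by simp)
    (fun e => by have := hx.1 _ _ (by omega) (by omega) e; omega)
    (hx.2 0 (by omega)).symm (hx.2 1 (by omega)) rfl
  intro u hu hu1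
  obtain ⟨i, hi, rfl⟩ := hham u
  have hi02 := (hS i hi).1 hu
  have hi1 : i ≠ 1 := fun h => hu1 (by rw [h])
  rcases lt_trichotomy i j with hlt | rfl | hgt
  · refine ⟨x (i + 1), (hS _ (by omega)).2 (by omega), hx.2 i (by omega), ?_⟩
    simp only [hidx i hi, hidx (i + 1) (by omega)]
    rw [if_neg (by omega), if_neg (by omega)]
    omega
  · refine ⟨x 1, (hS _ (by omega)).2 (by omega), h1j.symm, ?_⟩
    simp only [hidx i hi, hidx 1 (by omega)]
    rw [if_neg hi1]
    simp
  · have hadj := hx.2 (i - 1) (by omega)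
    rw [show i - 1 + 1 = i by omega] at hadj
    refine ⟨x (i - 1), (hS _ (by omega)).2 (by omega), hadj.symm, ?_⟩
    simp only [hidx i hi, hidx (i - 1) (by omega)]
    rw [if_neg (by omega), if_neg (by omega)]
    omega

lemma exists_adj_notMem (v : V) (T : Finset V) (hT : T.card < G.degree v) :
    ∃ w ∉ T, G.Adj v w := by
  rw [← card_neighborFinset_eq_degree] at hT
  obtain ⟨w, hw, hwT⟩ := Finset.exists_mem_notMem_of_card_lt_card hT
  exact ⟨w, hwT, by simpa using hw⟩

/-- A `2`-regular graph with a Hamiltonian path is a cycle. -/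
lemma IsPathSeq.nonempty_iso_cycleGraph (hdeg : ∀ v, G.degree v = 2) {x : ℕ → V} {m : ℕ}
    (hx : G.IsPathSeq x (m + 3)) (hham : ∀ v, ∃ i < m + 3, x i = v) :
    Nonempty (G ≃g cycleGraph (m + 3)) := by
  classical
  have hclose : G.Adj (x (m + 2)) (x 0) := by
    obtain ⟨w, hwT, hw⟩ := exists_adj_notMem (G := G) (x (m + 2)) {x (m + 1)}
      (by rw [hdeg, Finset.card_singleton]; omega)
    obtain ⟨j, hj, rfl⟩ := hham w
    have hj1 : j ≠ m + 1 := fun h => hwT (by simp [h])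
    have hj2 : j ≠ m + 2 := fun h => by rw [h] at hw; exact G.loopless.irrefl _ hw
    rcases Nat.eq_zero_or_pos j with rfl | hpos
    · exact hw
    have hp := hx.2 (j - 1) (by omega)
    rw [show j - 1 + 1 = j by omega] at hp
    have hsub : ({x (j - 1), x (j + 1), x (m + 2)} : Finset V) ⊆ G.neighborFinset (x j) := by
      simp [Finset.insert_subset_iff, hp.symm, hw.symm, hx.2 j (by omega)]
    have h1 : x (j - 1) ≠ x (j + 1) := fun e => by
      have := hx.1 _ _ (by omega) (by omega) e; omega
    have h2 : x (j - 1) ≠ x (m + 2) := fun e => by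
      have := hx.1 _ _ (by omega) (by omega) e; omega
    have h3 : x (j + 1) ≠ x (m + 2) := fun e => by
      have := hx.1 _ _ (by omega) (by omega) e; omega
    have hle := Finset.card_le_card hsub
    rw [card_neighborFinset_eq_degree, hdeg, Finset.card_eq_three.2 ⟨_, _, _, h1, h2, h3, rfl⟩]
      at hle
    omega
  have hbij : Function.Bijective fun i : Fin (m + 3) => x i :=
    ⟨fun i j h => Fin.ext (hx.1 i j i.2 j.2 h), fun v => by
      obtain ⟨i, hi, e⟩ := hham v
      exact ⟨⟨i, hi⟩, e⟩⟩
  have hstep : ∀ i j : Fin (m + 3), (i - j).val = 1 → G.Adj (x i) (x j) := by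
    intro i j h
    have hi := i.2
    have hj := j.2
    rcases le_or_gt j i with hle | hlt
    · rw [Fin.sub_val_of_le hle] at h
      have hle' : (j : ℕ) ≤ i := hle
      rw [show (i : ℕ) = j + 1 by omega]
      exact (hx.2 j (by omega)).symm
    · have hlt' : (i : ℕ) < j := hlt
      rw [Fin.coe_sub_iff_lt.2 hlt] at h
      rw [show (i : ℕ) = 0 by omega, show (j : ℕ) = m + 2 by omega]
      exact hclose.symm
  have hhom : ∀ i j : Fin (m + 3), (cycleGraph (m + 3)).Adj i j → G.Adj (x i) (x j) := by
    intro i j h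
    rcases cycleGraph_adj'.1 h with h | h
    · exact hstep i j h
    · exact (hstep j i h).symm
  refine ⟨(RelIso.mk (Equiv.ofBijective _ hbij) fun {i j} => ⟨fun h => ?_, hhom i j⟩ :
    cycleGraph (m + 3) ≃g G).symm⟩
  have hsub : ((cycleGraph (m + 3)).neighborFinset i).image (fun k : Fin (m + 3) => x k) ⊆
      G.neighborFinset (x i) := by
    intro v hv
    obtain ⟨k, hk, rfl⟩ := Finset.mem_image.1 hv
    simpa using hhom i k (by simpa using hk)
  have heq := Finset.eq_of_subset_of_card_le hsub (by
    rw [Finset.card_image_of_injective _ hbij.1, card_neighborFinset_eq_degree,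
      card_neighborFinset_eq_degree, hdeg, cycleGraph_degree_three_le])
  have hmem : x j ∈ G.neighborFinset (x i) := by simpa using h
  rw [← heq] at hmem
  obtain ⟨k, hk, e⟩ := Finset.mem_image.1 hmem
  rw [← hbij.1 e]
  simpa using hk

/-- If one vertex is critical, every critical vertex has degree at most `r`, and `G` is connected
but not `r`-colorable, then every vertex is critical. -/
lemma Connected.forall_exists_isProperOff (hconn : G.Connected) (hG : ¬ G.Colorable r)
    (hdeg : ∀ v, ∀ c : V → Fin r, G.IsProperOff c {v} → G.degree v ≤ r) {v : V} {c : V → Fin r}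
    (hc : G.IsProperOff c {v}) (w : V) : ∃ c : V → Fin r, G.IsProperOff c {w} := by
  obtain ⟨p⟩ := hconn.preconnected v w
  induction p generalizing c with
  | nil => exact ⟨c, hc⟩
  | cons h _ ih =>
    obtain ⟨c', hc'⟩ := hc.exists_adj hG (hdeg _ c hc) h
    exact ih hc'

/-- Brooks' theorem for connected vertex-critical graphs. -/
lemma Connected.eq_top_or_cycleGraph (hconn : G.Connected) (hG : ¬ G.Colorable r)
    (hdeg : ∀ v, G.degree v = r) (hcrit : ∀ v, ∃ c : V → Fin r, G.IsProperOff c {v}) :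
    G = ⊤ ∨ r = 2 ∧ ∃ m, Nonempty (G ≃g cycleGraph (m + 3)) := by
  classical
  by_cases hcompl : ∀ a b c, G.Adj a b → G.Adj b c → a ≠ c → G.Adj a c
  · left
    have hreach : ∀ a b, G.Walk a b → a = b ∨ G.Adj a b := by
      intro a b p
      induction p with
      | nil => exact .inl rfl
      | @cons a b c h _ ih =>
        by_cases hac : a = c
        · exact .inl hac
        · rcases ih with rfl | h'
          · exact .inr h
          · exact .inr (hcompl _ _ _ h h' hac)
    ext a b
    rw [top_adj]
    refine ⟨Adj.ne, fun hab => ?_⟩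
    obtain ⟨p⟩ := hconn.preconnected a b
    exact (hreach a b p).resolve_left hab
  · right
    push Not at hcompl
    obtain ⟨a, b, c, hab, hbc, hac, hnac⟩ := hcompl
    obtain ⟨x, n, hx, hn, rfl, rfl, rfl, hlast⟩ := exists_maximal_isPathSeq hab hbc hac
    have hham := hx.hamiltonian hG hconn (fun v => (hdeg v).le) hcrit (by omega) hlast
    have hr2 : 2 ≤ r := by
      have hsub : ({x 0, x 2} : Finset V) ⊆ G.neighborFinset (x 1) := by
        simp [Finset.insert_subset_iff, hab.symm, hbc]
      have := Finset.card_le_card hsub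
      rwa [card_neighborFinset_eq_degree, hdeg, Finset.card_pair hac] at this
    rcases hr2.eq_or_lt with rfl | hr3
    · obtain ⟨m, rfl⟩ := Nat.exists_eq_add_of_le' hn
      exact ⟨rfl, m, hx.nonempty_iso_cycleGraph hdeg hham⟩
    · exfalso
      obtain ⟨w, hwT, hw⟩ := exists_adj_notMem (G := G) (x 1) {x 0, x 2}
        (by rwa [hdeg, Finset.card_pair hac])
      obtain ⟨j, hj, rfl⟩ := hham w
      have hj0 : j ≠ 0 := fun h => hwT (by simp [h])
      have hj1 : j ≠ 1 := fun h => by rw [h] at hw; exact G.loopless.irrefl _ hw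
      have hj2 : j ≠ 2 := fun h => hwT (by simp [h])
      exact hG (hx.colorable_of_hamiltonian (fun v => (hdeg v).le) (by omega) hn hham hnac
        (by omega) hj hw)

end Finite

end SimpleGraph

/-- Let `F` be a connected `r`-critical graph (`χ(F) = r+1` and some edge `e` has
`χ(F−e) = r`). If every critical vertex of `F` has degree at most `r`, then
`F = K_{r+1}`, or `r = 2` and `F` is an odd cycle. -/
theorem connected_rCritical_smallDeg {V : Type*} [Fintype V] (r : ℕ)
    (F : SimpleGraph V) [DecidableRel F.Adj]
    (hconn : F.Connected)
    (hchrom : F.chromaticNumber = (r + 1 : ℕ))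
    (hedge : ∃ u v : V, F.Adj u v ∧
      (F.deleteEdges {s(u, v)}).chromaticNumber = (r : ℕ))
    (hcritdeg : ∀ v : V, (F.induce {v}ᶜ).chromaticNumber = (r : ℕ) → F.degree v ≤ r) :
    Nonempty (F ≃g (⊤ : SimpleGraph (Fin (r + 1)))) ∨
      (r = 2 ∧ ∃ k : ℕ, 1 ≤ k ∧ Nonempty (F ≃g SimpleGraph.cycleGraph (2 * k + 1))) := by
  have hG : ¬ F.Colorable r := fun h => by
    have hle := SimpleGraph.chromaticNumber_le_iff_colorable.2 h
    rw [hchrom, Nat.cast_le] at hle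
    omega
  have hcrit_deg : ∀ v, ∀ c : V → Fin r, F.IsProperOff c {v} → F.degree v ≤ r := fun v c hc =>
    hcritdeg v (hc.chromaticNumber_induce_compl hG)
  obtain ⟨u, v, huv, he⟩ := hedge
  obtain ⟨c₀⟩ := SimpleGraph.chromaticNumber_le_iff_colorable.1 he.le
  have hc₀ : F.IsProperOff c₀ {u} := fun a b ha hb hab => by
    refine c₀.valid ?_
    simp only [Finset.mem_singleton] at ha hb
    simp [SimpleGraph.deleteEdges_adj, hab, ha, hb]
  have hcrit := hconn.forall_exists_isProperOff hG hcrit_deg hc₀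
  have hdeg : ∀ v, F.degree v = r := fun v => by
    obtain ⟨c, hc⟩ := hcrit v
    exact (hc.injOn_neighborFinset hG (hcrit_deg v c hc)).2
  rcases hconn.eq_top_or_cycleGraph hG hdeg hcrit with rfl | ⟨rfl, m, ⟨e⟩⟩
  · left
    rw [SimpleGraph.chromaticNumber_top, Nat.cast_inj] at hchrom
    exact ⟨SimpleGraph.Iso.completeGraph (Fintype.equivFinOfCardEq hchrom)⟩
  · right
    rw [SimpleGraph.chromaticNumber_congr e] at hchrom
    rcases Nat.even_or_odd (m + 3) with heven | ⟨k, hk⟩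
    · rw [SimpleGraph.chromaticNumber_cycleGraph_of_even _ (by omega) heven] at hchrom
      norm_num at hchrom
    · exact ⟨rfl, k, by omega, ⟨hk ▸ e⟩⟩
end

section
/- Let n be divisible by r ≥ 4, and let H be obtained from the complete r-partite graph with all parts of size n/r by adding one edge inside part V₁ and one edge inside part V₂. Then the number of copies of K_{r+2}−e in H containing both added edges equals (C(r+2,2) − 2)(n/r)^{r−2} + (r−2)(r−3)·C(n/r, 2)·(n/r)^{r−4}. -/
/-- `K_{r+2}` minus one edge. -/
def cliqueMinusEdge (r : ℕ) : SimpleGraph (Fin (r + 2)) :=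
  (⊤ : SimpleGraph (Fin (r + 2))).deleteEdges {s(0, 1)}

theorem cliqueMinusEdge_adj {r : ℕ} {x y : Fin (r + 2)} :
    (cliqueMinusEdge r).Adj x y ↔ x ≠ y ∧ s(x, y) ≠ s(0, 1) := by
  simp only [cliqueMinusEdge, SimpleGraph.deleteEdges_adj, SimpleGraph.top_adj,
    Set.mem_singleton_iff, ne_eq]

theorem nonempty_iso_cliqueMinusEdge_iff {α : Type*} (G : SimpleGraph α) (r : ℕ) :
    Nonempty (G ≃g cliqueMinusEdge r) ↔ Nat.card α = r + 2 ∧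
      ∃ a b, a ≠ b ∧ ∀ x y, G.Adj x y ↔ x ≠ y ∧ s(x, y) ≠ s(a, b) := by
  constructor
  · rintro ⟨f⟩
    refine ⟨by simpa using Nat.card_congr f.toEquiv, f.symm 0, f.symm 1, by simp, fun x y => ?_⟩
    rw [← f.map_adj_iff]
    have h : s(x, y) = s(f.symm 0, f.symm 1) ↔ s(f x, f y) = s(0, 1) := by
      simp only [Sym2.eq_iff, RelIso.eq_symm_apply]
    rw [cliqueMinusEdge_adj, ne_eq, f.injective.eq_iff, ne_eq, ne_eq, ne_eq, h]
  · rintro ⟨hcard, a, b, hab, hadj⟩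
    have : Finite α := Nat.finite_of_card_ne_zero (by omega)
    let e₀ : α ≃ Fin (r + 2) := Finite.equivFinOfCardEq hcard
    let e₁ : α ≃ Fin (r + 2) := e₀.trans (Equiv.swap (e₀ a) 0)
    let e : α ≃ Fin (r + 2) := e₁.trans (Equiv.swap (e₁ b) 1)
    have h₁ : e₁ a = 0 := by simp [e₁]
    have h₂ : e₁ b ≠ 0 := by rw [← h₁]; simpa using hab.symm
    have ha : e a = 0 := by
      simp only [e, Equiv.trans_apply, h₁]
      exact Equiv.swap_apply_of_ne_of_ne h₂.symm (by simp)
    have hb : e b = 1 := by simp [e]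
    refine ⟨e, fun {x y} => ?_⟩
    have h : s(x, y) = s(a, b) ↔ s(e x, e y) = s(0, 1) := by
      simp only [Sym2.eq_iff, ← ha, ← hb, e.apply_eq_iff_eq]
    simp only [cliqueMinusEdge_adj, hadj, h, ne_eq, e.apply_eq_iff_eq]

theorem SimpleGraph.Subgraph.nonempty_coe_iso_cliqueMinusEdge_iff {V : Type*} {H : SimpleGraph V}
    (H' : H.Subgraph) (r : ℕ) :
    Nonempty (H'.coe ≃g cliqueMinusEdge r) ↔ H'.verts.ncard = r + 2 ∧
      ∃ a ∈ H'.verts, ∃ b ∈ H'.verts, a ≠ b ∧ ∀ x ∈ H'.verts, ∀ y ∈ H'.verts,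
        (H'.Adj x y ↔ x ≠ y ∧ s(x, y) ≠ s(a, b)) := by
  rw [nonempty_iso_cliqueMinusEdge_iff, Nat.card_coe_set_eq]
  simp only [Subtype.exists, Subtype.forall, SimpleGraph.Subgraph.coe_adj, Sym2.eq_iff, ne_eq,
    Subtype.mk.injEq, exists_prop]

theorem Finset.eq_one_of_sum_eq_card {ι : Type*} {s : Finset ι} {f : ι → ℕ}
    (hf : ∀ i ∈ s, f i ≤ 1) (hsum : ∑ i ∈ s, f i = s.card) : ∀ i ∈ s, f i = 1 :=
  (Finset.sum_eq_sum_iff_of_le hf).1 (by simpa using hsum)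

theorem Finset.exists_eq_zero_of_sum_add_one_eq_card {ι : Type*} [DecidableEq ι] {s : Finset ι}
    {f : ι → ℕ} (hf : ∀ i ∈ s, f i ≤ 1) (hsum : ∑ i ∈ s, f i + 1 = s.card) :
    ∃ k ∈ s, f k = 0 ∧ ∀ i ∈ s, i ≠ k → f i = 1 := by
  obtain ⟨k, hk, hfk⟩ : ∃ k ∈ s, f k = 0 := by
    by_contra! h
    have : ∑ i ∈ s, 1 ≤ ∑ i ∈ s, f i :=
      Finset.sum_le_sum fun i hi => Nat.one_le_iff_ne_zero.2 (h i hi)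
    simp at this
    omega
  refine ⟨k, hk, hfk, fun i hi hik => ?_⟩
  refine Finset.eq_one_of_sum_eq_card (s := s.erase k)
    (fun i hi => hf i (Finset.mem_of_mem_erase hi)) ?_ i (Finset.mem_erase.2 ⟨hik, hi⟩)
  have := Finset.add_sum_erase s f hk
  have := Finset.card_erase_add_one hk
  omega

/-- The size profile equal to `2` at `k.1`, to `0` at `k.2`, and to `1` elsewhere. -/
def doubledSkipped {ι : Type*} [DecidableEq ι] (k : ι × ι) (i : ι) : ℕ :=
  if i = k.1 then 2 else if i = k.2 then 0 else 1

theorem sum_doubledSkipped {ι : Type*} [DecidableEq ι] {s : Finset ι} {k : ι × ι}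
    (hk : k ∈ s.offDiag) :
    ∑ i ∈ s, doubledSkipped k i = s.card := by
  obtain ⟨h₁, h₂, hne⟩ := Finset.mem_offDiag.1 hk
  have h₂' : k.2 ∈ s.erase k.1 := Finset.mem_erase.2 ⟨hne.symm, h₂⟩
  rw [← Finset.add_sum_erase _ _ h₁, ← Finset.add_sum_erase _ _ h₂',
    Finset.sum_congr rfl (g := fun _ => 1)]
  · have := Finset.card_erase_add_one h₁
    have := Finset.card_erase_add_one h₂'
    simp [doubledSkipped, hne.symm]
    omega
  · intro i hi
    simp only [Finset.mem_erase] at hi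
    simp [doubledSkipped, hi]

theorem prod_choose_doubledSkipped {ι : Type*} [DecidableEq ι] {s : Finset ι} {k : ι × ι}
    (hk : k ∈ s.offDiag) (m : ℕ) :
    ∏ i ∈ s, m.choose (doubledSkipped k i) = m.choose 2 * m ^ (s.card - 2) := by
  obtain ⟨h₁, h₂, hne⟩ := Finset.mem_offDiag.1 hk
  have h₂' : k.2 ∈ s.erase k.1 := Finset.mem_erase.2 ⟨hne.symm, h₂⟩
  rw [← Finset.mul_prod_erase _ _ h₁, ← Finset.mul_prod_erase _ _ h₂',
    Finset.prod_congr rfl (g := fun _ => m)]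
  · simp [doubledSkipped, hne.symm, Finset.card_erase_of_mem h₂', Finset.card_erase_of_mem h₁,
      Nat.sub_sub]
  · intro i hi
    simp only [Finset.mem_erase] at hi
    simp [doubledSkipped, hi]

section TwoAddedEdges

variable {ι α : Type*} [Fintype ι] [DecidableEq ι] [DecidableEq α] {H : SimpleGraph (Σ _ : ι, α)}
  {i₀ i₁ : ι} {p₁ q₁ p₂ q₂ : α}

/-- `H` is the complete multipartite graph with parts `{i} × α`, with one edge `p₁q₁` added inside
part `i₀` and one edge `p₂q₂` added inside part `i₁`. -/
def IsMultipartiteAddTwoEdges (H : SimpleGraph (Σ _ : ι, α)) (i₀ i₁ : ι) (p₁ q₁ p₂ q₂ : α) :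
    Prop :=
  ∀ x y, H.Adj x y ↔ x.1 ≠ y.1 ∨ (x ≠ y ∧
    (s(x, y) = s(⟨i₀, p₁⟩, ⟨i₀, q₁⟩) ∨ s(x, y) = s(⟨i₁, p₂⟩, ⟨i₁, q₂⟩)))

/-- The indices other than `i₀` and `i₁`. -/
def otherParts (i₀ i₁ : ι) : Finset ι := (Finset.univ.erase i₀).erase i₁

/-- The families of subsets of the parts equal to `{p₁, q₁}` at `i₀`, to `{p₂, q₂}` at `i₁`, and of
size `c i` at every other index `i`. -/
def familiesWithSizes [Fintype α] (i₀ i₁ : ι) (p₁ q₁ p₂ q₂ : α) (c : ι → ℕ) :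
    Finset (ι → Finset α) :=
  Fintype.piFinset fun i => if i = i₀ then {{p₁, q₁}} else if i = i₁ then {{p₂, q₂}} else
    Finset.univ.powersetCard (c i)

theorem mem_otherParts {i : ι} : i ∈ otherParts i₀ i₁ ↔ i ≠ i₀ ∧ i ≠ i₁ := by
  simp [otherParts, and_comm]

theorem card_otherParts (hi : i₀ ≠ i₁) : (otherParts i₀ i₁).card = Fintype.card ι - 2 := by
  rw [otherParts, Finset.card_erase_of_mem (by simpa using hi.symm), Finset.card_erase_of_mem
    (Finset.mem_univ _), Finset.card_univ, Nat.sub_sub]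

theorem mem_familiesWithSizes [Fintype α] (hi : i₀ ≠ i₁) {c : ι → ℕ} {t : ι → Finset α} :
    t ∈ familiesWithSizes i₀ i₁ p₁ q₁ p₂ q₂ c ↔ t i₀ = {p₁, q₁} ∧ t i₁ = {p₂, q₂} ∧
      ∀ i ∈ otherParts i₀ i₁, (t i).card = c i := by
  simp only [familiesWithSizes, Fintype.mem_piFinset, mem_otherParts]
  constructor
  · intro h
    refine ⟨by simpa using h i₀, by simpa [hi.symm] using h i₁, fun i hi => ?_⟩
    simpa [hi.1, hi.2] using h i
  · rintro ⟨h₀, h₁, h⟩ i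
    split_ifs with hi₀ hi₁
    · simp [hi₀, h₀]
    · simp [hi₁, h₁]
    · simpa using h i ⟨hi₀, hi₁⟩

theorem card_familiesWithSizes [Fintype α] (hi : i₀ ≠ i₁) (c : ι → ℕ) :
    (familiesWithSizes i₀ i₁ p₁ q₁ p₂ q₂ c).card =
      ∏ i ∈ otherParts i₀ i₁, (Fintype.card α).choose (c i) := by
  rw [familiesWithSizes, Fintype.card_piFinset, ← Finset.mul_prod_erase _ _ (Finset.mem_univ i₀),
    ← Finset.mul_prod_erase _ _ (Finset.mem_erase.2 ⟨hi.symm, Finset.mem_univ i₁⟩)]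
  simp only [if_true, hi.symm, if_false, Finset.card_singleton, one_mul]
  refine Finset.prod_congr rfl fun i h => ?_
  have := mem_otherParts.1 h
  simp [this.1, this.2]

theorem card_univ_sigma_eq (hi : i₀ ≠ i₁) (hpq₁ : p₁ ≠ q₁) (hpq₂ : p₂ ≠ q₂) {t : ι → Finset α}
    (h₀ : t i₀ = {p₁, q₁}) (h₁ : t i₁ = {p₂, q₂}) :
    (Finset.univ.sigma t).card = 4 + ∑ i ∈ otherParts i₀ i₁, (t i).card := by
  rw [Finset.card_sigma, ← Finset.add_sum_erase _ _ (Finset.mem_univ i₀),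
    ← Finset.add_sum_erase _ _ (Finset.mem_erase.2 ⟨hi.symm, Finset.mem_univ i₁⟩), h₀, h₁,
    Finset.card_pair hpq₁, Finset.card_pair hpq₂, ← add_assoc, otherParts]

theorem card_univ_sigma_eq_of_sum_eq (hi : i₀ ≠ i₁) (hpq₁ : p₁ ≠ q₁) (hpq₂ : p₂ ≠ q₂)
    {t : ι → Finset α} (h₀ : t i₀ = {p₁, q₁}) (h₁ : t i₁ = {p₂, q₂}) :
    (Finset.univ.sigma t).card = Fintype.card ι + 2 ↔
      ∑ i ∈ otherParts i₀ i₁, (t i).card = (otherParts i₀ i₁).card := by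
  have : 2 ≤ Fintype.card ι := Fintype.one_lt_card_iff.2 ⟨i₀, i₁, hi⟩
  rw [card_univ_sigma_eq hi hpq₁ hpq₂ h₀ h₁, card_otherParts hi]
  omega

theorem IsMultipartiteAddTwoEdges.adj_iff (hH : IsMultipartiteAddTwoEdges H i₀ i₁ p₁ q₁ p₂ q₂)
    {t : ι → Finset α} (h₀ : t i₀ = {p₁, q₁}) (h₁ : t i₁ = {p₂, q₂}) {x y : Σ _ : ι, α}
    (hx : x.2 ∈ t x.1) (hy : y.2 ∈ t y.1) :
    H.Adj x y ↔ x ≠ y ∧ (x.1 = y.1 → x.1 ∉ otherParts i₀ i₁) := by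
  obtain ⟨i, c⟩ := x
  obtain ⟨j, d⟩ := y
  rw [hH, mem_otherParts]
  simp only [Sym2.eq_iff, Sigma.mk.injEq, heq_eq_eq, ne_eq] at *
  by_cases hij : i = j
  · subst hij
    by_cases hi₀ : i = i₀
    · subst hi₀
      simp only [h₀, Finset.mem_insert, Finset.mem_singleton] at hx hy
      grind
    by_cases hi₁ : i = i₁
    · subst hi₁
      simp only [h₁, Finset.mem_insert, Finset.mem_singleton] at hx hy
      grind
    simp [hi₀, hi₁]
  · simp [hij]

theorem IsMultipartiteAddTwoEdges.eq_pairs_of_adj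
    (hH : IsMultipartiteAddTwoEdges H i₀ i₁ p₁ q₁ p₂ q₂) (hi : i₀ ≠ i₁) (hpq₁ : p₁ ≠ q₁)
    (hpq₂ : p₂ ≠ q₂) {t : ι → Finset α} (h₀ : {p₁, q₁} ⊆ t i₀) (h₁ : {p₂, q₂} ⊆ t i₁)
    {e : Sym2 (Σ _ : ι, α)}
    (hadj : ∀ x ∈ Finset.univ.sigma t, ∀ y ∈ Finset.univ.sigma t, x ≠ y → s(x, y) ≠ e → H.Adj x y) :
    t i₀ = {p₁, q₁} ∧ t i₁ = {p₂, q₂} := by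
  have key : ∀ (i : ι) (p q : α), p ≠ q → {p, q} ⊆ t i →
      (∀ c, c ≠ p → c ≠ q → ∀ d, ¬ H.Adj ⟨i, c⟩ ⟨i, d⟩) → t i = {p, q} := by
    intro i p q hpq hsub hnadj
    refine (Finset.Subset.antisymm hsub fun c hc => ?_).symm
    by_contra hcpq
    simp only [Finset.mem_insert, Finset.mem_singleton, not_or] at hcpq
    have mem (d) (hd : d ∈ t i) : (⟨i, d⟩ : Σ _ : ι, α) ∈ Finset.univ.sigma t := by simpa using hd
    have hp : s((⟨i, c⟩ : Σ _ : ι, α), ⟨i, p⟩) = e := by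
      by_contra h
      exact hnadj c hcpq.1 hcpq.2 p
        (hadj _ (mem c hc) _ (mem p (hsub (by simp))) (by simpa using hcpq.1) h)
    have hq : s((⟨i, c⟩ : Σ _ : ι, α), ⟨i, q⟩) = e := by
      by_contra h
      exact hnadj c hcpq.1 hcpq.2 q
        (hadj _ (mem c hc) _ (mem q (hsub (by simp))) (by simpa using hcpq.2) h)
    exact hpq (by simpa using Sym2.congr_right.1 (hp.trans hq.symm))
  constructor
  · refine key i₀ p₁ q₁ hpq₁ h₀ fun c hcp hcq d => ?_
    rw [hH]
    simp [hcp, hcq, hi]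
  · refine key i₁ p₂ q₂ hpq₂ h₁ fun c hcp hcq d => ?_
    rw [hH]
    simp [hcp, hcq, hi.symm]

theorem IsMultipartiteAddTwoEdges.mem_families_of_adj [Fintype α]
    (hH : IsMultipartiteAddTwoEdges H i₀ i₁ p₁ q₁ p₂ q₂) (hi : i₀ ≠ i₁) (hpq₁ : p₁ ≠ q₁)
    (hpq₂ : p₂ ≠ q₂) {t : ι → Finset α} (h₀ : {p₁, q₁} ⊆ t i₀) (h₁ : {p₂, q₂} ⊆ t i₁)
    (hcard : (Finset.univ.sigma t).card = Fintype.card ι + 2) {a b : Σ _ : ι, α}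
    (ha : a ∈ Finset.univ.sigma t) (hb : b ∈ Finset.univ.sigma t) (hab : a ≠ b)
    (hadj : ∀ x ∈ Finset.univ.sigma t, ∀ y ∈ Finset.univ.sigma t, x ≠ y → s(x, y) ≠ s(a, b) →
      H.Adj x y) :
    (H.Adj a b ∧ t ∈ familiesWithSizes i₀ i₁ p₁ q₁ p₂ q₂ fun _ => 1) ∨
    (¬ H.Adj a b ∧ ∃ k ∈ (otherParts i₀ i₁).offDiag,
      t ∈ familiesWithSizes i₀ i₁ p₁ q₁ p₂ q₂ (doubledSkipped k)) := by
  obtain ⟨h₀, h₁⟩ := hH.eq_pairs_of_adj hi hpq₁ hpq₂ h₀ h₁ hadj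
  rw [card_univ_sigma_eq_of_sum_eq hi hpq₁ hpq₂ h₀ h₁] at hcard
  simp only [mem_familiesWithSizes hi, h₀, h₁, true_and]
  simp only [Finset.mem_sigma, Finset.mem_univ, true_and] at ha hb hadj
  have single {i : ι} (hio : i ∈ otherParts i₀ i₁)
      (hne : ∀ c d, s((⟨i, c⟩ : Σ _ : ι, α), ⟨i, d⟩) ≠ s(a, b)) : (t i).card ≤ 1 := by
    refine Finset.card_le_one.2 fun c hc d hd => ?_
    by_contra hcd
    have := hadj ⟨i, c⟩ hc ⟨i, d⟩ hd (by simpa using hcd) (hne c d)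
    rw [hH.adj_iff h₀ h₁ hc hd] at this
    exact this.2 rfl hio
  by_cases hHab : H.Adj a b
  · refine .inl ⟨hHab, Finset.eq_one_of_sum_eq_card (fun i hio => single hio fun c d h => ?_) hcard⟩
    have hcd : H.Adj ⟨i, c⟩ ⟨i, d⟩ := by
      rwa [← SimpleGraph.mem_edgeSet, h]
    have hc : c ∈ t i ∧ d ∈ t i := by
      rcases Sym2.eq_iff.1 h with ⟨rfl, rfl⟩ | ⟨rfl, rfl⟩ <;> simp_all
    rw [hH.adj_iff h₀ h₁ hc.1 hc.2] at hcd
    exact hcd.2 rfl hio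
  · refine .inr ⟨hHab, ?_⟩
    have hab' := hHab
    rw [hH.adj_iff h₀ h₁ ha hb] at hab'
    simp only [ne_eq, hab, not_false_eq_true, true_and, Classical.not_imp, not_not] at hab'
    obtain ⟨k, c⟩ := a
    obtain ⟨k', d⟩ := b
    obtain ⟨rfl : k = k', hk⟩ := hab'
    have hcd : c ≠ d := by simpa using hab
    have htk : t k = {c, d} := by
      refine (Finset.Subset.antisymm (by simp_all [Finset.insert_subset_iff]) fun x hx => ?_).symm
      by_contra hxcd
      simp only [Finset.mem_insert, Finset.mem_singleton, not_or] at hxcd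
      have := hadj ⟨k, x⟩ hx ⟨k, c⟩ ha (by simpa using hxcd.1) (by simp [hxcd])
      rw [hH.adj_iff h₀ h₁ hx ha] at this
      exact this.2 rfl hk
    have hk2 : (t k).card = 2 := by rw [htk, Finset.card_pair hcd]
    obtain ⟨l, hl, hl0, hl1⟩ := Finset.exists_eq_zero_of_sum_add_one_eq_card
      (s := (otherParts i₀ i₁).erase k) (f := fun i => (t i).card)
      (fun i hi => single (Finset.mem_of_mem_erase hi)
        fun x y => by simp [Finset.ne_of_mem_erase hi])
      (by
        dsimp only at hk ⊢
        have := Finset.add_sum_erase _ (fun i => (t i).card) hk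
        have := Finset.card_erase_add_one hk
        omega)
    refine ⟨(k, l), Finset.mem_offDiag.2 ⟨hk, Finset.mem_of_mem_erase hl,
      (Finset.ne_of_mem_erase hl).symm⟩, fun i hio => ?_⟩
    simp only [doubledSkipped]
    split_ifs with hik hil
    · rw [hik, hk2]
    · rw [hil, hl0]
    · exact hl1 i (Finset.mem_erase.2 ⟨hik, hio⟩) hil

end TwoAddedEdges

section Counting

open Finset

variable {ι α : Type*} {H : SimpleGraph (Σ _ : ι, α)} {i₀ i₁ : ι} {p₁ q₁ p₂ q₂ : α}

/-- The copies of `K_{r+2}` minus an edge in `H` which contain both added edges. -/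
def copiesThroughPair (H : SimpleGraph (Σ _ : ι, α)) (r : ℕ) (i₀ i₁ : ι) (p₁ q₁ p₂ q₂ : α) :
    Set H.Subgraph :=
  {H' | Nonempty (H'.coe ≃g cliqueMinusEdge r) ∧
    s(⟨i₀, p₁⟩, ⟨i₀, q₁⟩) ∈ H'.edgeSet ∧ s(⟨i₁, p₂⟩, ⟨i₁, q₂⟩) ∈ H'.edgeSet}

variable [Fintype ι]

/-- The pairs of distinct vertices of `⋃ i, {i} × t i` other than the two added edges. -/
def removablePairs [DecidableEq ι] [DecidableEq α] (i₀ i₁ : ι) (p₁ q₁ p₂ q₂ : α)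
    (t : ι → Finset α) : Finset (Sym2 (Σ _ : ι, α)) :=
  (univ.sigma t).offDiag.image Sym2.mk.uncurry \
    {s(⟨i₀, p₁⟩, ⟨i₀, q₁⟩), s(⟨i₁, p₂⟩, ⟨i₁, q₂⟩)}

theorem mk_mem_removablePairs [DecidableEq ι] [DecidableEq α] {t : ι → Finset α}
    {x y : Σ _ : ι, α} :
    s(x, y) ∈ removablePairs i₀ i₁ p₁ q₁ p₂ q₂ t ↔ (x.2 ∈ t x.1 ∧ y.2 ∈ t y.1 ∧ x ≠ y) ∧
      s(x, y) ≠ s(⟨i₀, p₁⟩, ⟨i₀, q₁⟩) ∧ s(x, y) ≠ s(⟨i₁, p₂⟩, ⟨i₁, q₂⟩) := by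
  have : s(x, y) ∈ (univ.sigma t).offDiag.image Sym2.mk.uncurry ↔
      x.2 ∈ t x.1 ∧ y.2 ∈ t y.1 ∧ x ≠ y := by
    simp only [mem_image, mem_offDiag, Prod.exists, Function.uncurry_apply_pair, mem_sigma,
      mem_univ, true_and]
    constructor
    · rintro ⟨a, b, h, hab⟩
      rcases Sym2.eq_iff.1 hab with ⟨rfl, rfl⟩ | ⟨rfl, rfl⟩
      exacts [h, ⟨h.2.1, h.1, h.2.2.symm⟩]
    · exact fun h => ⟨x, y, h, rfl⟩
  simp only [removablePairs, mem_sdiff, this, mem_insert, mem_singleton, not_or, ne_eq]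

theorem card_removablePairs [DecidableEq ι] [DecidableEq α] (hi : i₀ ≠ i₁)
    (hpq₁ : p₁ ≠ q₁) (hpq₂ : p₂ ≠ q₂)
    {t : ι → Finset α} (h₀ : t i₀ = {p₁, q₁}) (h₁ : t i₁ = {p₂, q₂})
    (hcard : (univ.sigma t).card = Fintype.card ι + 2) :
    (removablePairs i₀ i₁ p₁ q₁ p₂ q₂ t).card = (Fintype.card ι + 2).choose 2 - 2 := by
  rw [removablePairs, card_sdiff_of_subset, Sym2.card_image_offDiag, hcard, card_pair]
  · simp [hi]
  · simp only [insert_subset_iff, singleton_subset_iff, mem_image, mem_offDiag, Prod.exists]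
    exact ⟨⟨_, _, by simp [h₀, hpq₁], rfl⟩, ⟨_, _, by simp [h₁, hpq₂], rfl⟩⟩

/-- The subgraph of `H` induced on `⋃ i, {i} × t i`. -/
def inducedOnFamily (H : SimpleGraph (Σ _ : ι, α)) (t : ι → Finset α) : H.Subgraph :=
  (⊤ : H.Subgraph).induce (univ.sigma t : Finset _)

theorem inducedOnFamily_verts (t : ι → Finset α) :
    (inducedOnFamily H t).verts = (univ.sigma t : Finset _) := rfl

theorem inducedOnFamily_adj {t : ι → Finset α} {x y : Σ _ : ι, α} :
    (inducedOnFamily H t).Adj x y ↔ x.2 ∈ t x.1 ∧ y.2 ∈ t y.1 ∧ H.Adj x y := by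
  simp [inducedOnFamily]

theorem eq_of_inducedOnFamily_verts_eq {t t' : ι → Finset α}
    (h : (inducedOnFamily H t).verts = (inducedOnFamily H t').verts) : t = t' := by
  simp only [inducedOnFamily_verts, coe_inj] at h
  ext i c
  simpa using Finset.ext_iff.1 h ⟨i, c⟩

theorem inducedOnFamily_injective :
    Function.Injective (inducedOnFamily H : (ι → Finset α) → H.Subgraph) :=
  fun _ _ h => eq_of_inducedOnFamily_verts_eq (congrArg SimpleGraph.Subgraph.verts h)

theorem exists_eq_univ_sigma [Fintype α] (s : Set (Σ _ : ι, α)) :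
    ∃ t : ι → Finset α, s = (univ.sigma t : Finset _) := by
  classical
  exact ⟨fun i => univ.filter fun c => ⟨i, c⟩ ∈ s, by ext ⟨i, c⟩; simp⟩

theorem IsMultipartiteAddTwoEdges.adj_iff_ne_of_mem_familiesWithSizes_one [DecidableEq ι]
    [Fintype α] [DecidableEq α] (hH : IsMultipartiteAddTwoEdges H i₀ i₁ p₁ q₁ p₂ q₂) (hi : i₀ ≠ i₁)
    {t : ι → Finset α} (ht : t ∈ familiesWithSizes i₀ i₁ p₁ q₁ p₂ q₂ fun _ => 1)
    {x y : Σ _ : ι, α} (hx : x.2 ∈ t x.1) (hy : y.2 ∈ t y.1) : H.Adj x y ↔ x ≠ y := by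
  obtain ⟨h₀, h₁, hsizes⟩ := (mem_familiesWithSizes hi).1 ht
  rw [hH.adj_iff h₀ h₁ hx hy, and_iff_left_iff_imp]
  obtain ⟨i, c⟩ := x
  obtain ⟨j, d⟩ := y
  rintro hne (rfl : i = j) hio
  exact hne (by rw [card_le_one.1 (hsizes i hio).le c hx d hy])

theorem IsMultipartiteAddTwoEdges.copiesThroughPair_eq [DecidableEq ι] [Fintype α]
    [DecidableEq α] (hH : IsMultipartiteAddTwoEdges H i₀ i₁ p₁ q₁ p₂ q₂) (hi : i₀ ≠ i₁)
    (hpq₁ : p₁ ≠ q₁) (hpq₂ : p₂ ≠ q₂) :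
    copiesThroughPair H (Fintype.card ι) i₀ i₁ p₁ q₁ p₂ q₂ =
      (fun x : (_ : ι → Finset α) × Sym2 (Σ _ : ι, α) =>
          (inducedOnFamily H x.1).deleteEdges {x.2}) ''
        ((familiesWithSizes i₀ i₁ p₁ q₁ p₂ q₂ fun _ => 1).sigma
          (removablePairs i₀ i₁ p₁ q₁ p₂ q₂) : Finset _) ∪
      inducedOnFamily H '' ((otherParts i₀ i₁).offDiag.biUnion fun k =>
        familiesWithSizes i₀ i₁ p₁ q₁ p₂ q₂ (doubledSkipped k) : Finset _) := by
  ext H'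
  simp only [copiesThroughPair, Set.mem_ofPred_eq, Set.mem_union, Set.mem_image, mem_coe,
    mem_sigma, mem_biUnion, SimpleGraph.Subgraph.mem_edgeSet,
    SimpleGraph.Subgraph.nonempty_coe_iso_cliqueMinusEdge_iff]
  constructor
  · rintro ⟨⟨hcard, a, ha, b, hb, hab, hadj⟩, he₁, he₂⟩
    obtain ⟨t, ht⟩ := exists_eq_univ_sigma H'.verts
    have hverts {x} : x ∈ H'.verts ↔ x.2 ∈ t x.1 := by simp [ht]
    have hadj' (x y) : H'.Adj x y ↔ x.2 ∈ t x.1 ∧ y.2 ∈ t y.1 ∧ x ≠ y ∧ s(x, y) ≠ s(a, b) := by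
      constructor
      · intro h
        exact ⟨hverts.1 h.fst_mem, hverts.1 h.snd_mem, (hadj x h.fst_mem y h.snd_mem).1 h⟩
      · exact fun h => (hadj x (hverts.2 h.1) y (hverts.2 h.2.1)).2 h.2.2
    have h₀ : {p₁, q₁} ⊆ t i₀ := by
      simpa [insert_subset_iff] using And.intro (hverts.1 he₁.fst_mem) (hverts.1 he₁.snd_mem)
    have h₁ : {p₂, q₂} ⊆ t i₁ := by
      simpa [insert_subset_iff] using And.intro (hverts.1 he₂.fst_mem) (hverts.1 he₂.snd_mem)
    have hHadj (x) (hx : x ∈ univ.sigma t) (y) (hy : y ∈ univ.sigma t) (hxy : x ≠ y)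
        (hne : s(x, y) ≠ s(a, b)) : H.Adj x y :=
      H'.adj_sub ((hadj' x y).2 ⟨by simpa using hx, by simpa using hy, hxy, hne⟩)
    have hcard' : (univ.sigma t).card = Fintype.card ι + 2 := by
      rw [← hcard, ht, Set.ncard_coe_finset]
    rw [hverts] at ha hb
    rcases hH.mem_families_of_adj hi hpq₁ hpq₂ h₀ h₁ hcard' (by simpa using ha) (by simpa using hb)
      hab hHadj with ⟨hHab, hmem⟩ | ⟨hHab, k, hk, hmem⟩
    · refine .inl ⟨⟨t, s(a, b)⟩, ⟨hmem, mk_mem_removablePairs.2 ⟨⟨ha, hb, hab⟩, ?_, ?_⟩⟩, ?_⟩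
      · exact fun h => ((hadj' _ _).1 he₁).2.2.2 h.symm
      · exact fun h => ((hadj' _ _).1 he₂).2.2.2 h.symm
      · refine SimpleGraph.Subgraph.ext ht.symm ?_
        ext x y
        simp only [SimpleGraph.Subgraph.deleteEdges_adj, inducedOnFamily_adj, hadj',
          Set.mem_singleton_iff]
        constructor
        · rintro ⟨⟨hx, hy, h⟩, hne⟩
          exact ⟨hx, hy, h.ne, hne⟩
        · rintro ⟨hx, hy, hxy, hne⟩
          exact ⟨⟨hx, hy, hHadj x (by simpa using hx) y (by simpa using hy) hxy hne⟩, hne⟩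
    · refine .inr ⟨t, ⟨k, hk, hmem⟩, SimpleGraph.Subgraph.ext ht.symm ?_⟩
      ext x y
      simp only [inducedOnFamily_adj, hadj']
      constructor
      · rintro ⟨hx, hy, h⟩
        refine ⟨hx, hy, h.ne, fun he => hHab ?_⟩
        rwa [← SimpleGraph.mem_edgeSet, ← he]
      · rintro ⟨hx, hy, hxy, hne⟩
        exact ⟨hx, hy, hHadj x (by simpa using hx) y (by simpa using hy) hxy hne⟩
  · rintro (⟨⟨t, e⟩, ⟨ht, he⟩, rfl⟩ | ⟨t, ⟨k, hk, ht⟩, rfl⟩)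
    · dsimp only at ht he
      obtain ⟨h₀, h₁, hsizes⟩ := (mem_familiesWithSizes hi).1 ht
      induction e with | _ a b
      obtain ⟨⟨ha, hb, hab⟩, hne₁, hne₂⟩ := mk_mem_removablePairs.1 he
      have hclique {x y : Σ _ : ι, α} (hx : x.2 ∈ t x.1) (hy : y.2 ∈ t y.1) :
          H.Adj x y ↔ x ≠ y :=
        hH.adj_iff_ne_of_mem_familiesWithSizes_one hi ht hx hy
      refine ⟨⟨?_, a, by simpa [inducedOnFamily_verts] using ha, b,
        by simpa [inducedOnFamily_verts] using hb, hab, fun x hx y hy => ?_⟩, ?_, ?_⟩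
      · simp only [SimpleGraph.Subgraph.deleteEdges_verts, inducedOnFamily_verts,
          Set.ncard_coe_finset]
        rw [card_univ_sigma_eq_of_sum_eq hi hpq₁ hpq₂ h₀ h₁, sum_congr rfl hsizes, sum_const,
          smul_eq_mul, mul_one]
      · simp only [SimpleGraph.Subgraph.deleteEdges_verts, inducedOnFamily_verts, coe_sigma,
          Set.mem_sigma_iff, mem_coe, mem_univ, true_and] at hx hy
        simp [inducedOnFamily_adj, hx, hy, hclique hx hy]
      · rw [SimpleGraph.Subgraph.deleteEdges_adj, inducedOnFamily_adj,
          hclique (by simp [h₀]) (by simp [h₀])]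
        exact ⟨by simp [h₀, hpq₁], hne₁.symm⟩
      · rw [SimpleGraph.Subgraph.deleteEdges_adj, inducedOnFamily_adj,
          hclique (by simp [h₁]) (by simp [h₁])]
        exact ⟨by simp [h₁, hpq₂], hne₂.symm⟩
    · obtain ⟨h₀, h₁, hsizes⟩ := (mem_familiesWithSizes hi).1 ht
      have hk₁ := (mem_offDiag.1 hk).1
      obtain ⟨c, d, hcd, htk⟩ : ∃ c d, c ≠ d ∧ t k.1 = {c, d} :=
        card_eq_two.1 (by simpa [doubledSkipped] using hsizes _ hk₁)
      refine ⟨⟨?_, ⟨k.1, c⟩, by simp [inducedOnFamily_verts, htk], ⟨k.1, d⟩,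
        by simp [inducedOnFamily_verts, htk], by simpa using hcd, fun x hx y hy => ?_⟩, ?_, ?_⟩
      · rw [inducedOnFamily_verts, Set.ncard_coe_finset,
          card_univ_sigma_eq_of_sum_eq hi hpq₁ hpq₂ h₀ h₁, sum_congr rfl hsizes,
          sum_doubledSkipped hk]
      · simp only [inducedOnFamily_verts, coe_sigma, Set.mem_sigma_iff, mem_coe, mem_univ,
          true_and] at hx hy
        rw [inducedOnFamily_adj, hH.adj_iff h₀ h₁ hx hy]
        simp only [hx, hy, true_and]
        refine and_congr_right fun hxy => ?_
        obtain ⟨i, x⟩ := x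
        obtain ⟨j, y⟩ := y
        dsimp only at hx hy ⊢
        constructor
        · intro h he
          have hij : i = k.1 ∧ j = k.1 := by
            rcases Sym2.eq_iff.1 he with ⟨h, h'⟩ | ⟨h, h'⟩ <;> simp_all
          exact h (hij.1.trans hij.2.symm) (hij.1 ▸ hk₁)
        · rintro hne rfl hio
          have hxy' : x ≠ y := by simpa using hxy
          by_cases hik : i = k.1
          · subst hik
            simp only [htk, mem_insert, mem_singleton] at hx hy
            rcases hx with rfl | rfl <;> rcases hy with rfl | rfl <;> simp_all [Sym2.eq_swap]
          · refine hxy' (card_le_one.1 ?_ x hx y hy)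
            rw [hsizes i hio, doubledSkipped, if_neg hik]
            split_ifs <;> simp
      · rw [inducedOnFamily_adj, hH.adj_iff h₀ h₁ (by simp [h₀]) (by simp [h₀])]
        simp [h₀, hpq₁, mem_otherParts]
      · rw [inducedOnFamily_adj, hH.adj_iff h₀ h₁ (by simp [h₁]) (by simp [h₁])]
        simp [h₁, hpq₂, mem_otherParts]

theorem IsMultipartiteAddTwoEdges.ncard_copiesThroughPair [DecidableEq ι] [Fintype α]
    [DecidableEq α] (hH : IsMultipartiteAddTwoEdges H i₀ i₁ p₁ q₁ p₂ q₂) (hi : i₀ ≠ i₁)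
    (hpq₁ : p₁ ≠ q₁) (hpq₂ : p₂ ≠ q₂) :
    (copiesThroughPair H (Fintype.card ι) i₀ i₁ p₁ q₁ p₂ q₂).ncard =
      ((Fintype.card ι + 2).choose 2 - 2) * Fintype.card α ^ (Fintype.card ι - 2) +
        (Fintype.card ι - 2) * (Fintype.card ι - 3) * (Fintype.card α).choose 2 *
          Fintype.card α ^ (Fintype.card ι - 4) := by
  rw [hH.copiesThroughPair_eq hi hpq₁ hpq₂, Set.ncard_union_eq ?_ (Set.toFinite _) (Set.toFinite _),
    Set.InjOn.ncard_image, Set.ncard_image_of_injective _ inducedOnFamily_injective,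
    Set.ncard_coe_finset, Set.ncard_coe_finset, card_sigma, card_biUnion]
  · congr 1
    · rw [sum_congr rfl (g := fun _ => (Fintype.card ι + 2).choose 2 - 2), sum_const,
        card_familiesWithSizes hi, smul_eq_mul, mul_comm]
      · simp [card_otherParts hi]
      · intro t ht
        obtain ⟨h₀, h₁, hsizes⟩ := (mem_familiesWithSizes hi).1 ht
        refine card_removablePairs hi hpq₁ hpq₂ h₀ h₁ ?_
        rw [card_univ_sigma_eq_of_sum_eq hi hpq₁ hpq₂ h₀ h₁, sum_congr rfl hsizes, sum_const,
          smul_eq_mul, mul_one]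
    · rw [sum_congr rfl fun k hk =>
        (card_familiesWithSizes hi _).trans (prod_choose_doubledSkipped hk _), sum_const,
        smul_eq_mul, offDiag_card, card_otherParts hi, ← Nat.mul_sub_one, Nat.sub_sub, Nat.sub_sub,
        mul_assoc _ ((Fintype.card α).choose 2)]
  · intro k hk l hl hkl
    refine disjoint_left.2 fun t htk htl => hkl ?_
    have hsizes (i) (hio : i ∈ otherParts i₀ i₁) : doubledSkipped k i = doubledSkipped l i :=
      (((mem_familiesWithSizes hi).1 htk).2.2 i hio).symm.trans
        (((mem_familiesWithSizes hi).1 htl).2.2 i hio)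
    obtain ⟨hk₁, hk₂, hk⟩ := mem_offDiag.1 hk
    have h₁ := hsizes _ hk₁
    have h₂ := hsizes _ hk₂
    simp only [doubledSkipped, if_true, hk.symm, if_false] at h₁ h₂
    refine Prod.ext ?_ ?_
    · grind
    · grind
  · rintro ⟨t, e⟩ hx ⟨t', e'⟩ hx' h
    simp only [coe_sigma, Set.mem_sigma_iff, mem_coe] at hx hx'
    dsimp only at h
    obtain rfl : t = t' := eq_of_inducedOnFamily_verts_eq (H := H)
      (by simpa using congrArg SimpleGraph.Subgraph.verts h)
    obtain rfl : e = e' := by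
      induction e with | _ a b
      by_contra hne
      obtain ⟨⟨ha, hb, hab⟩, -, -⟩ := mk_mem_removablePairs.1 hx.2
      have hH' := (hH.adj_iff_ne_of_mem_familiesWithSizes_one hi hx.1 ha hb).2 hab
      have : ((inducedOnFamily H t).deleteEdges {s(a, b)}).Adj a b := by
        rw [h, SimpleGraph.Subgraph.deleteEdges_adj, inducedOnFamily_adj]
        exact ⟨⟨ha, hb, hH'⟩, hne⟩
      simp at this
    rfl
  · refine Set.disjoint_left.2 ?_
    rintro _ ⟨⟨t, e⟩, hx, rfl⟩ ⟨t', ht', h⟩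
    simp only [coe_sigma, Set.mem_sigma_iff, mem_coe] at hx
    obtain rfl : t' = t :=
      eq_of_inducedOnFamily_verts_eq (H := H)
        (by simpa using congrArg SimpleGraph.Subgraph.verts h)
    obtain ⟨k, hk, ht'⟩ := mem_biUnion.1 ht'
    have hk₁ := (mem_offDiag.1 hk).1
    have h₁ := ((mem_familiesWithSizes hi).1 hx.1).2.2 _ hk₁
    have h₂ := ((mem_familiesWithSizes hi).1 ht').2.2 _ hk₁
    simp [doubledSkipped, h₁] at h₂

end Counting

/-- Let `r ∣ n`, `r ≥ 4`, and let `H` be the complete `r`-partite graph with all parts of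
size `n/r`, plus one added edge inside part `0` and one added edge inside part `1`. Then
the number of copies of `K_{r+2}−e` in `H` containing both added edges equals
`(C(r+2,2) − 2)(n/r)^{r−2} + (r−2)(r−3)·C(n/r, 2)·(n/r)^{r−4}`. -/
theorem copies_through_pair_in_two_parts (r n : ℕ) (hr : 4 ≤ r) (hdvd : r ∣ n)
    (h2 : 2 ≤ n / r)
    (u₁ v₁ u₂ v₂ : Σ _ : Fin r, Fin (n / r)) (i0 i1 : Fin r)
    (hi0 : (i0 : ℕ) = 0) (hi1 : (i1 : ℕ) = 1)
    (hu₁ : u₁.1 = i0) (hv₁ : v₁.1 = i0) (hu₂ : u₂.1 = i1) (hv₂ : v₂.1 = i1)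
    (hne₁ : u₁ ≠ v₁) (hne₂ : u₂ ≠ v₂)
    (H : SimpleGraph (Σ _ : Fin r, Fin (n / r)))
    (hH : H = SimpleGraph.completeMultipartiteGraph (fun _ : Fin r => Fin (n / r)) ⊔
      SimpleGraph.fromEdgeSet {s(u₁, v₁), s(u₂, v₂)}) :
    Set.ncard {H' : H.Subgraph | Nonempty (H'.coe ≃g cliqueMinusEdge r) ∧
        s(u₁, v₁) ∈ H'.edgeSet ∧ s(u₂, v₂) ∈ H'.edgeSet} =
      ((r + 2).choose 2 - 2) * (n / r) ^ (r - 2) +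
        (r - 2) * (r - 3) * (n / r).choose 2 * (n / r) ^ (r - 4) := by
  obtain ⟨j₀, p₁⟩ := u₁
  obtain ⟨_, q₁⟩ := v₁
  obtain ⟨j₁, p₂⟩ := u₂
  obtain ⟨_, q₂⟩ := v₂
  dsimp only at hu₁ hv₁ hu₂ hv₂
  subst hv₁ hv₂ hu₁ hu₂
  have hi : j₀ ≠ j₁ := by
    rintro rfl
    omega
  have hH' : IsMultipartiteAddTwoEdges H j₀ j₁ p₁ q₁ p₂ q₂ := by
    intro x y
    subst hH
    simp only [SimpleGraph.sup_adj, SimpleGraph.fromEdgeSet_adj, Set.mem_insert_iff,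
      Set.mem_singleton_iff, SimpleGraph.completeMultipartiteGraph, SimpleGraph.comap_adj,
      SimpleGraph.top_adj]
    tauto
  have key := hH'.ncard_copiesThroughPair hi (by simpa using hne₁) (by simpa using hne₂)
  simp only [Fintype.card_fin] at key
  exact key
end
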